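/- Let A be the 8×8 Cartan matrix of type E_8 with nodes labeled so that nodes 1–2–3–4–5–6–7 form a chain and node 8 is attached to node 5 (A_{ii} = 2; A_{ij} = −1 exactly when {i,j} ∈ {{1,2},{2,3},{3,4},{4,5},{5,6},{6,7},{5,8}}; A_{ij} = 0 otherwise). Let Φ⁺ = { c ∈ ℕ^8 : cᵀ A c = 2 }, which has exactly 120 elements (the positive roots of E_8). Then in ℤ[[q, y_1, …, y_8]]: ∏_{c ∈ Φ⁺} ∏_{n≥1} (1 − q^n y_1^{c_1} ⋯ y_8^{c_8})^{−1} = ∑ over all 8-tuples (r_1, …, r_8) of descending sequences of q^{E} · ( ∏_{i=1}^{8} y_i^{|r_i|} ) · ∏_{i=1}^{8} ∏_{j≥1} (q;q)_{r_i^{(j)} − r_i^{(j+1)}}^{−1}, where E = ∑_{i=1}^{8} ∑_{t≥1} (r_i^{(t)})² − ∑_{t≥1} ( r_1^{(t)} r_2^{(t)} + r_2^{(t)} r_3^{(t)} + r_3^{(t)} r_4^{(t)} + r_4^{(t)} r_5^{(t)} + r_5^{(t)} r_6^{(t)} + r_6^{(t)} r_7^{(t)} + r_5^{(t)} r_8^{(t)}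 ); here E is a nonnegative integer. -/

import Mathlib

open MvPowerSeries

/-- The product topology (coefficientwise convergence) on multivariate formal power series. -/
noncomputable instance (σ R : Type*) [TopologicalSpace R] :
    TopologicalSpace (MvPowerSeries σ R) :=
  inferInstanceAs (TopologicalSpace ((σ →₀ ℕ) → R))

/-- `r : ℕ → ℕ` is a descending sequence (indexed so that `r t = r^{(t+1)}`):
nonincreasing and eventually zero. -/
def IsDescending (r : ℕ → ℕ) : Prop :=
  Antitone r ∧ ∃ N, ∀ t ≥ N, r t = 0

/-- The Cartan matrix of type `E₈` (0-indexed: nodes `0–1–2–3–4–5–6` form a chain and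
node `7` is attached to node `4`; these are the paper's nodes `1,…,8`). -/
def cartanE8 : Matrix (Fin 8) (Fin 8) ℤ :=
  !![ 2, -1,  0,  0,  0,  0,  0,  0;
     -1,  2, -1,  0,  0,  0,  0,  0;
      0, -1,  2, -1,  0,  0,  0,  0;
      0,  0, -1,  2, -1,  0,  0,  0;
      0,  0,  0, -1,  2, -1,  0, -1;
      0,  0,  0,  0, -1,  2, -1,  0;
      0,  0,  0,  0,  0, -1,  2,  0;
      0,  0,  0,  0, -1,  0,  0,  2]

section PowerSeriesSums

open Finset

variable {K : Type*} [Field K]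

/-- If each member of a family of power series is a multiple of `X` times another member,
then all members vanish. -/
lemma eq_zero_of_forall_eq_X_mul {R ι : Type*} [CommRing R] (Δ : ι → PowerSeries R)
    (next : ι → ι) (g : ι → PowerSeries R)
    (h : ∀ j, Δ j = PowerSeries.X * (g j * Δ (next j))) (j : ι) : Δ j = 0 := by
  have key : ∀ n j, (PowerSeries.X : PowerSeries R) ^ n ∣ Δ j := by
    intro n
    induction n with
    | zero => simp
    | succ n ih =>
      intro j
      rw [h j, pow_succ']
      exact mul_dvd_mul_left _ ((ih _).mul_left _)
  ext n
  exact (PowerSeries.X_pow_dvd_iff.mp (key (n + 1) j)) n n.lt_succ_self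

/-- The power series `∑ s, X ^ s * u s`. -/
noncomputable def sumX (u : ℕ → PowerSeries K) : PowerSeries K :=
  PowerSeries.mk fun k => ∑ p ∈ antidiagonal k, PowerSeries.coeff p.2 (u p.1)

lemma coeff_sumX (u : ℕ → PowerSeries K) (k : ℕ) :
    PowerSeries.coeff k (sumX u) = ∑ p ∈ antidiagonal k, PowerSeries.coeff p.2 (u p.1) :=
  PowerSeries.coeff_mk _ _

lemma sumX_eq_add (u : ℕ → PowerSeries K) :
    sumX u = u 0 + PowerSeries.X * sumX fun s => u (s + 1) := by
  ext k
  cases k with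
  | zero => simp [coeff_sumX]
  | succ k =>
    rw [map_add, PowerSeries.coeff_succ_X_mul, coeff_sumX, coeff_sumX,
      Finset.Nat.sum_antidiagonal_succ]

lemma sumX_add (u v : ℕ → PowerSeries K) :
    sumX (fun s => u s + v s) = sumX u + sumX v := by
  ext k; simp [coeff_sumX, sum_add_distrib]

lemma sumX_sub (u v : ℕ → PowerSeries K) :
    sumX (fun s => u s - v s) = sumX u - sumX v := by
  ext k; simp [coeff_sumX]

lemma mul_sumX (F : PowerSeries K) (u : ℕ → PowerSeries K) :
    F * sumX u = sumX fun s => F * u s := by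
  have := eq_zero_of_forall_eq_X_mul
    (fun u : ℕ → PowerSeries K => F * sumX u - sumX fun s => F * u s)
    (fun u s => u (s + 1)) (fun _ => 1)
    (fun u => by
      rw [sumX_eq_add u, sumX_eq_add fun s => F * u s]
      ring) u
  exact sub_eq_zero.mp this

lemma rescale_sumX (c : K) (u : ℕ → PowerSeries K) :
    PowerSeries.rescale c (sumX u) = sumX fun s => PowerSeries.C (c ^ s) * PowerSeries.rescale c (u s) := by
  ext k
  simp only [PowerSeries.coeff_rescale, coeff_sumX, PowerSeries.coeff_C_mul, mul_sum]
  refine sum_congr rfl fun p hp => ?_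
  rw [← mem_antidiagonal.mp hp, pow_add, mul_assoc]

end PowerSeriesSums

section QSeries

open Finset

variable {K : Type*} [Field K] (q : K)

/-- The finite `q`-factorial `(q;q)_m`. -/
def qFact (m : ℕ) : K := ∏ u ∈ range m, (1 - q ^ (u + 1))

lemma qFact_zero : qFact q 0 = 1 := by simp [qFact]

lemma qFact_succ (m : ℕ) : qFact q (m + 1) = qFact q m * (1 - q ^ (m + 1)) :=
  prod_range_succ _ _

variable {q}

lemma qFact_ne_zero (hq : ∀ n : ℕ, q ^ (n + 1) ≠ 1) (m : ℕ) : qFact q m ≠ 0 :=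
  prod_ne_zero_iff.mpr fun u _ => sub_ne_zero.mpr (hq u).symm

variable (q)

/-- The linear factor `1 - q ^ n * X`. -/
noncomputable def linFactor (n : ℕ) : PowerSeries K := 1 - PowerSeries.C (q ^ n) * PowerSeries.X

/-- The product `(qX;q)_m`. -/
noncomputable def xPoch (m : ℕ) : PowerSeries K := ∏ n ∈ range m, linFactor q (n + 1)

lemma xPoch_succ (m : ℕ) : xPoch q (m + 1) = xPoch q m * linFactor q (m + 1) :=
  prod_range_succ _ _

lemma rescale_C (c d : K) : PowerSeries.rescale c (PowerSeries.C d) = PowerSeries.C d := by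
  ext n
  rw [PowerSeries.coeff_rescale, PowerSeries.coeff_C]
  split_ifs with h <;> simp [h]

lemma rescale_linFactor (n : ℕ) : PowerSeries.rescale q (linFactor q n) = linFactor q (n + 1) := by
  simp only [linFactor, map_sub, map_one, map_mul, rescale_C, PowerSeries.rescale_X, pow_succ]
  ring

lemma linFactor_mul_rescale_xPoch (m : ℕ) :
    linFactor q 1 * PowerSeries.rescale q (xPoch q m) = xPoch q (m + 1) := by
  rw [xPoch, map_prod, xPoch, prod_range_succ']
  simp only [rescale_linFactor]
  rw [mul_comm]

lemma constantCoeff_linFactor (n : ℕ) : PowerSeries.constantCoeff (linFactor q n) = 1 := by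
  simp [linFactor]

lemma constantCoeff_xPoch (m : ℕ) : PowerSeries.constantCoeff (xPoch q m) = 1 := by
  simp [xPoch, map_prod, constantCoeff_linFactor]

lemma linFactor_ne_zero (n : ℕ) : linFactor q n ≠ 0 := fun h => by
  simpa [h] using constantCoeff_linFactor q n

lemma xPoch_ne_zero (m : ℕ) : xPoch q m ≠ 0 := fun h => by
  simpa [h] using constantCoeff_xPoch q m

lemma xPoch_mul_inv (m : ℕ) : xPoch q m * (xPoch q m)⁻¹ = 1 :=
  PowerSeries.mul_inv_cancel _ (by simp [constantCoeff_xPoch])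

lemma rescale_xPoch_inv (m : ℕ) :
    PowerSeries.rescale q (xPoch q m)⁻¹ = linFactor q 1 * (xPoch q (m + 1))⁻¹ := by
  have h1 : PowerSeries.rescale q (xPoch q m) * PowerSeries.rescale q (xPoch q m)⁻¹ = 1 := by
    rw [← map_mul, xPoch_mul_inv, map_one]
  have h2 := xPoch_mul_inv q (m + 1)
  have h3 := linFactor_mul_rescale_xPoch q m
  have h0 : xPoch q (m + 1) ≠ 0 := xPoch_ne_zero q _
  apply mul_left_cancel₀ h0
  linear_combination (-PowerSeries.rescale q (xPoch q m)⁻¹) * h3 + linFactor q 1 * h1 - linFactor q 1 * h2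

lemma xPoch_inv_eq (m : ℕ) :
    (xPoch q m)⁻¹ = linFactor q (m + 1) * (xPoch q (m + 1))⁻¹ := by
  have h1 := xPoch_mul_inv q m
  have h2 := xPoch_mul_inv q (m + 1)
  have h3 := xPoch_succ q m
  apply mul_left_cancel₀ (xPoch_ne_zero q m)
  linear_combination h1 - h2 + (xPoch q (m + 1))⁻¹ * h3

/-- The coefficient `1 / (q;q)_{R-s}`, understood as zero for `s > R`. -/
noncomputable def truncWeight (R s : ℕ) : K := if s ≤ R then (qFact q (R - s))⁻¹ else 0

/-- The summand `q ^ (s ^ 2 + j * s) / ((q;q)_s (qX;q)_{s+j})` of a Durfee rectangle sum. -/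
noncomputable def durfeeTerm (j s : ℕ) : PowerSeries K :=
  PowerSeries.C (q ^ (s ^ 2 + j * s) * (qFact q s)⁻¹) * (xPoch q (s + j))⁻¹

lemma rescale_durfeeTerm (s : ℕ) :
    PowerSeries.C (q ^ s) * PowerSeries.rescale q (durfeeTerm q 0 s)
      = linFactor q 1 * durfeeTerm q 1 s := by
  simp only [durfeeTerm, map_mul, rescale_C, add_zero, rescale_xPoch_inv, pow_add, zero_mul, one_mul]
  ring

variable {q}

/-- The Durfee rectangle sums do not depend on the shape of the rectangle. -/
lemma sumX_durfeeTerm_succ (hq : ∀ n : ℕ, q ^ (n + 1) ≠ 1) (j : ℕ) :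
    sumX (durfeeTerm q j) = sumX (durfeeTerm q (j + 1)) := by
  have step : ∀ j, sumX (durfeeTerm q j) - sumX (durfeeTerm q (j + 1))
      = PowerSeries.X * (-PowerSeries.C (q ^ (j + 1)) *
        (sumX (durfeeTerm q (j + 1)) - sumX (durfeeTerm q (j + 1 + 1)))) := by
    intro j
    have hterm : ∀ s, durfeeTerm q j s - durfeeTerm q (j + 1) s =
        PowerSeries.C (1 - q ^ s) * PowerSeries.C (q ^ (s ^ 2 + j * s) * (qFact q s)⁻¹)
          * (xPoch q (s + (j + 1)))⁻¹
        - PowerSeries.C (q ^ (j + 1)) * PowerSeries.X * durfeeTerm q (j + 1) s := by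
      intro s
      have h := xPoch_inv_eq q (s + j)
      rw [durfeeTerm, durfeeTerm, h, linFactor, add_assoc s j 1]
      simp only [map_sub, map_mul, map_one, pow_add, add_mul, one_mul, map_pow]
      ring
    rw [← sumX_sub]
    simp only [hterm]
    rw [sumX_sub, ← mul_sumX, sumX_eq_add]
    have hshift : ∀ s, PowerSeries.C (1 - q ^ (s + 1))
          * PowerSeries.C (q ^ ((s + 1) ^ 2 + j * (s + 1)) * (qFact q (s + 1))⁻¹)
          * (xPoch q (s + 1 + (j + 1)))⁻¹
        = PowerSeries.C (q ^ (j + 1)) * durfeeTerm q (j + 1 + 1) s := by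
      intro s
      have h1 : (1 - q ^ (s + 1)) ≠ 0 := sub_ne_zero.mpr (hq s).symm
      have h2 := qFact_ne_zero hq s
      rw [durfeeTerm, ← mul_assoc, ← map_mul, ← map_mul,
        show s + 1 + (j + 1) = s + (j + 1 + 1) by ring]
      congr 2
      rw [qFact_succ]
      field_simp
      ring
    simp only [hshift]
    rw [← mul_sumX]
    simp
    ring
  exact sub_eq_zero.mp (eq_zero_of_forall_eq_X_mul
    (fun j => sumX (durfeeTerm q j) - sumX (durfeeTerm q (j + 1))) Nat.succ _ step j)

/-- The functional equation of the Durfee square sum. -/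
lemma rescale_sumX_durfeeTerm (hq : ∀ n : ℕ, q ^ (n + 1) ≠ 1) :
    PowerSeries.rescale q (sumX (durfeeTerm q 0)) = linFactor q 1 * sumX (durfeeTerm q 0) := by
  rw [rescale_sumX]
  simp only [rescale_durfeeTerm]
  rw [← mul_sumX, ← sumX_durfeeTerm_succ hq 0]

variable (q) in
/-- The power series `1 / (qX;q)_∞ = ∑ m, q ^ m X ^ m / (q;q)_m`. -/
noncomputable def qExp : PowerSeries K := PowerSeries.mk fun m => q ^ m * (qFact q m)⁻¹

lemma eq_qExp_of_rescale (hq : ∀ n : ℕ, q ^ (n + 1) ≠ 1) {F : PowerSeries K}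
    (h0 : PowerSeries.coeff 0 F = 1) (h : PowerSeries.rescale q F = linFactor q 1 * F) : F = qExp q := by
  ext m
  induction m with
  | zero => simp [h0, qExp, qFact_zero]
  | succ m ih =>
    have h1 := congrArg (PowerSeries.coeff (m + 1)) h
    rw [linFactor, sub_mul, one_mul, mul_assoc, map_sub, PowerSeries.coeff_C_mul,
      PowerSeries.coeff_succ_X_mul, ih, PowerSeries.coeff_rescale] at h1
    simp only [qExp, PowerSeries.coeff_mk] at h1 ⊢
    have h2 : (1 - q ^ (m + 1)) ≠ 0 := sub_ne_zero.mpr (hq m).symm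
    have h3 := qFact_ne_zero hq m
    rw [qFact_succ]
    field_simp at h1 ⊢
    linear_combination -h1

lemma sumX_durfeeTerm_zero (hq : ∀ n : ℕ, q ^ (n + 1) ≠ 1) :
    sumX (durfeeTerm q 0) = qExp q :=
  eq_qExp_of_rescale hq (by simp [coeff_sumX, durfeeTerm, qFact_zero, xPoch])
    (rescale_sumX_durfeeTerm hq)

lemma rescale_qExp (hq : ∀ n : ℕ, q ^ (n + 1) ≠ 1) :
    PowerSeries.rescale q (qExp q) = linFactor q 1 * qExp q := by
  rw [← sumX_durfeeTerm_zero hq, rescale_sumX_durfeeTerm hq]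

/-- The terminating form of the Durfee square identity. -/
lemma sumX_truncWeight (hq : ∀ n : ℕ, q ^ (n + 1) ≠ 1) (R : ℕ) :
    sumX (fun s => PowerSeries.C (truncWeight q R s) * durfeeTerm q 0 s)
      = PowerSeries.C (qFact q R)⁻¹ * (xPoch q R)⁻¹ := by
  induction R with
  | zero =>
    rw [sumX_eq_add]
    have h : sumX (fun s => PowerSeries.C (truncWeight q 0 (s + 1)) * durfeeTerm q 0 (s + 1))
        = 0 := by
      ext k; simp [coeff_sumX, truncWeight]
    rw [h]
    simp [truncWeight, qFact_zero, durfeeTerm]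
  | succ R ih =>
    have hR : (1 - q ^ (R + 1)) ≠ 0 := sub_ne_zero.mpr (hq R).symm
    have hshift : ∀ s, PowerSeries.C (1 - q ^ (R + 1)) *
          (PowerSeries.C (truncWeight q (R + 1) (s + 1)) * durfeeTerm q 0 (s + 1))
        = PowerSeries.C (truncWeight q R (s + 1)) * durfeeTerm q 0 (s + 1)
          + PowerSeries.C (q ^ (R + 1)) *
            (PowerSeries.C (truncWeight q R s) * durfeeTerm q 1 s) := by
      intro s
      simp only [durfeeTerm, ← mul_assoc, ← map_mul, add_zero]
      rw [← add_mul, ← map_add]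
      congr 2
      have h1 : (1 - q ^ (s + 1)) ≠ 0 := sub_ne_zero.mpr (hq s).symm
      have h2 := qFact_ne_zero hq s
      rcases lt_trichotomy s R with h | rfl | h
      · obtain ⟨m, rfl⟩ := Nat.exists_eq_add_of_lt h
        have h3 : (1 - q ^ (m + 1)) ≠ 0 := sub_ne_zero.mpr (hq m).symm
        have h4 := qFact_ne_zero hq m
        rw [truncWeight, truncWeight, truncWeight, if_pos (by omega), if_pos (by omega),
          if_pos (by omega), show s + m + 1 + 1 - (s + 1) = m + 1 by omega,
          show s + m + 1 - (s + 1) = m by omega, show s + m + 1 - s = m + 1 by omega,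
          qFact_succ, qFact_succ]
        field_simp
        ring
      · simp only [truncWeight, if_pos le_rfl, tsub_self, qFact_zero, qFact_succ,
          if_neg (Nat.not_succ_le_self s)]
        field_simp
        ring
      · simp only [truncWeight, if_neg (show ¬ s + 1 ≤ R + 1 by omega),
          if_neg (show ¬ s + 1 ≤ R by omega), if_neg (show ¬ s ≤ R by omega)]
        ring
    have hzero : PowerSeries.C (1 - q ^ (R + 1)) *
          (PowerSeries.C (truncWeight q (R + 1) 0) * durfeeTerm q 0 0)
        = PowerSeries.C (truncWeight q R 0) * durfeeTerm q 0 0 := by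
      have h4 := qFact_ne_zero hq R
      rw [← mul_assoc, ← map_mul]
      congr 2
      simp only [truncWeight, zero_le, if_true, Nat.sub_zero, qFact_succ]
      field_simp
    have hone : sumX (fun s => PowerSeries.C (truncWeight q R s) * durfeeTerm q 1 s)
        = PowerSeries.C (qFact q R)⁻¹ * (xPoch q (R + 1))⁻¹ := by
      have h := congrArg (PowerSeries.rescale q) ih
      rw [rescale_sumX, map_mul, rescale_C, rescale_xPoch_inv] at h
      have h' : ∀ s, PowerSeries.C (q ^ s) * PowerSeries.rescale q
          (PowerSeries.C (truncWeight q R s) * durfeeTerm q 0 s)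
          = linFactor q 1 * (PowerSeries.C (truncWeight q R s) * durfeeTerm q 1 s) := by
        intro s
        rw [map_mul, rescale_C, mul_left_comm, rescale_durfeeTerm, mul_left_comm]
      simp only [h'] at h
      rw [← mul_sumX] at h
      apply mul_left_cancel₀ (linFactor_ne_zero q 1)
      rw [h]
      ring
    apply mul_left_cancel₀ ((map_ne_zero_iff _ PowerSeries.C_injective).mpr hR)
    rw [mul_sumX, sumX_eq_add, hzero]
    simp only [hshift]
    rw [sumX_add, ← mul_sumX, mul_add, ← add_assoc, ← sumX_eq_add
      (fun s => PowerSeries.C (truncWeight q R s) * durfeeTerm q 0 s), ih, hone,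
      xPoch_inv_eq q R, linFactor, ← mul_assoc (PowerSeries.C (1 - q ^ (R + 1))), ← map_mul,
      qFact_succ, show (1 - q ^ (R + 1)) * (qFact q R * (1 - q ^ (R + 1)))⁻¹ = (qFact q R)⁻¹ by
        have h4 := qFact_ne_zero hq R
        field_simp]
    ring

end QSeries

section DescendingSequences

open Finset

@[to_additive]
lemma finprod_eq_prod_range {M : Type*} [CommMonoid M] {f : ℕ → M} {B : ℕ}
    (h : ∀ t ≥ B, f t = 1) : ∏ᶠ t, f t = ∏ t ∈ range B, f t := by
  refine finprod_eq_prod_of_mulSupport_subset f fun t ht => ?_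
  simp only [coe_range, Set.mem_Iio]
  by_contra hlt
  exact ht (h t (not_lt.mp hlt))

@[to_additive]
lemma finprod_nat_eq_mul {M : Type*} [CommMonoid M] {f : ℕ → M} {B : ℕ}
    (h : ∀ t ≥ B, f t = 1) : ∏ᶠ t, f t = f 0 * ∏ᶠ t, f (t + 1) := by
  rw [finprod_eq_prod_range (B := B + 1) fun t ht => h t (by omega),
    finprod_eq_prod_range (B := B) fun t ht => h (t + 1) (by omega), prod_range_succ', mul_comm]

/-- The type of descending sequences. -/
abbrev DescSeq := {r : ℕ → ℕ // IsDescending r}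

namespace DescSeq

/-- The zero sequence. -/
def zero : DescSeq := ⟨fun _ => 0, antitone_const, 0, fun _ _ => rfl⟩

/-- The sum of the entries. -/
noncomputable def size (r : DescSeq) : ℕ := ∑ᶠ t, r.1 t

/-- The sequence with its first entry removed. -/
def tail (r : DescSeq) : DescSeq :=
  ⟨fun t => r.1 (t + 1), fun _ _ h => r.2.1 (Nat.succ_le_succ h),
    r.2.2.imp fun _ hB t ht => hB (t + 1) (by omega)⟩

/-- The sequence with a new first entry. -/
def cons (s : ℕ) (r : DescSeq) (h : r.1 0 ≤ s) : DescSeq :=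
  ⟨fun t => Nat.casesOn t s r.1, antitone_nat_of_succ_le fun t => by
      cases t with
      | zero => exact h
      | succ t => exact r.2.1 t.le_succ,
    r.2.2.elim fun B hB => ⟨B + 1, fun t ht => by
      cases t with
      | zero => omega
      | succ t => exact hB t (by omega)⟩⟩

lemma size_eq_add (r : DescSeq) : r.size = r.1 0 + r.tail.size := by
  obtain ⟨B, hB⟩ := r.2.2
  exact finsum_nat_eq_add hB

lemma size_zero : zero.size = 0 := finsum_zero

lemma eq_zero_of_head_eq_zero {r : DescSeq} (h : r.1 0 = 0) : r = zero :=
  Subtype.ext (funext fun t => Nat.le_zero.mp (h ▸ r.2.1 t.zero_le))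

lemma tail_cons (s : ℕ) (r : DescSeq) (h : r.1 0 ≤ s) : (cons s r h).tail = r := rfl

lemma cons_tail (r : DescSeq) : cons (r.1 0) r.tail (r.2.1 (Nat.zero_le 1)) = r :=
  Subtype.ext (funext fun t => by cases t <;> rfl)

lemma size_cons (s : ℕ) (r : DescSeq) (h : r.1 0 ≤ s) : (cons s r h).size = s + r.size := by
  rw [size_eq_add, tail_cons]; rfl

lemma ext_head_tail {r r' : DescSeq} (h0 : r.1 0 = r'.1 0) (ht : r.tail = r'.tail) : r = r' := by
  refine Subtype.ext (funext fun t => ?_)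
  cases t with
  | zero => exact h0
  | succ t => exact congrFun (congrArg Subtype.val ht) t

lemma finite_size_eq (n : ℕ) : {r : DescSeq | r.size = n}.Finite := by
  induction n using Nat.strong_induction_on with
  | _ n ih =>
    have hU : (insert zero {r : DescSeq | r.size = n ∧ r.1 0 ≠ 0}).Finite := by
      refine Set.Finite.insert _ ?_
      refine Set.Finite.of_injOn (f := tail) (t := ⋃ m ∈ Set.Iio n, {r : DescSeq | r.size = m})
        ?_ ?_ ((Set.finite_Iio n).biUnion fun m hm => ih m hm)
      · rintro r ⟨h1, h2⟩
        have := r.size_eq_add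
        simp only [Set.mem_iUnion, Set.mem_ofPred_eq, exists_prop, exists_eq_right', Set.mem_Iio]
        omega
      · rintro r ⟨h1, -⟩ r' ⟨h2, -⟩ h
        refine ext_head_tail ?_ h
        have e1 := r.size_eq_add
        have e2 := r'.size_eq_add
        rw [h] at e1
        omega
    refine hU.subset fun r hr => ?_
    by_cases h : r.1 0 = 0
    · exact Or.inl (eq_zero_of_head_eq_zero h)
    · exact Or.inr ⟨hr, h⟩

/-- The finite set of descending sequences with a given sum of entries. -/
noncomputable def level (n : ℕ) : Finset DescSeq := (finite_size_eq n).toFinset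

lemma mem_level {n : ℕ} {r : DescSeq} : r ∈ level n ↔ r.size = n := by simp [level]

lemma size_eq_zero_iff {r : DescSeq} : r.size = 0 ↔ r = zero := by
  refine ⟨fun h => eq_zero_of_head_eq_zero ?_, fun h => h ▸ size_zero⟩
  have := r.size_eq_add
  omega

lemma level_zero : level 0 = {zero} := by
  ext r; simp [mem_level, size_eq_zero_iff]

/-- Summation over descending sequences by the first entry and the remaining sequence. -/
lemma sum_level {M : Type*} [AddCommMonoid M] (n : ℕ) (h : ℕ → DescSeq → M) :
    ∑ r ∈ level n, h (r.1 0) r.tail = ∑ p ∈ antidiagonal n, ∑ r ∈ level p.2,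
      if r.1 0 ≤ p.1 then h p.1 r else 0 := by
  simp only [← sum_filter]
  rw [sum_sigma']
  refine sum_bij' (i := fun r _ => ⟨(r.1 0, r.tail.size), r.tail⟩)
    (j := fun x hx => cons x.1.1 x.2 (mem_filter.mp (mem_sigma.mp hx).2).2) ?_ ?_ ?_ ?_ ?_
  · intro r hr
    simp only [mem_sigma, HasAntidiagonal.mem_antidiagonal, mem_filter, mem_level, true_and]
    exact ⟨by rw [← size_eq_add, mem_level.mp hr], r.2.1 (Nat.zero_le 1)⟩
  · rintro ⟨⟨s, m⟩, r⟩ hx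
    simp only [mem_sigma, HasAntidiagonal.mem_antidiagonal, mem_filter, mem_level] at hx
    rw [mem_level, size_cons, hx.2.1, hx.1]
  · intro r _
    exact r.cons_tail
  · rintro ⟨⟨s, m⟩, r⟩ hx
    simp only [mem_sigma, HasAntidiagonal.mem_antidiagonal, mem_filter, mem_level] at hx
    obtain ⟨-, rfl, -⟩ := hx
    rfl
  · intro r _
    rfl

end DescSeq

open DescSeq

variable {K : Type*} [Field K] (q : K)

/-- The product of the `q`-factorials of the consecutive differences of a sequence. -/
noncomputable def descFact (r : ℕ → ℕ) : K := ∏ᶠ t, (qFact q (r t - r (t + 1)))⁻¹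

/-- The weight `q ^ (∑ t, r_t ^ 2 - r_t N_t) / ∏ t, (q;q)_{r_t - r_{t+1}}`. -/
noncomputable def descWeight (N : ℕ → ℕ) (r : DescSeq) : K :=
  q ^ (∑ᶠ t, ((r.1 t : ℤ) ^ 2 - r.1 t * N t)) * descFact q r.1

/-- The generating function of descending sequences, with a factor depending on the
first entry. -/
noncomputable def descSeries (κ : ℕ → K) (N : ℕ → ℕ) : PowerSeries K :=
  PowerSeries.mk fun n => ∑ r ∈ level n, κ (r.1 0) * descWeight q N r

variable {q}

lemma descWeight_eq (hq0 : q ≠ 0) (N : ℕ → ℕ) (r : DescSeq) :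
    descWeight q N r = q ^ ((r.1 0 : ℤ) ^ 2 - r.1 0 * N 0) *
      ((qFact q (r.1 0 - r.tail.1 0))⁻¹ * descWeight q (fun t => N (t + 1)) r.tail) := by
  obtain ⟨B, hB⟩ := r.2.2
  rw [descWeight, descFact, finsum_nat_eq_add (B := B) fun t ht => by simp [hB t ht],
    finprod_nat_eq_mul (B := B) fun t ht => by simp [hB t ht, qFact_zero], zpow_add₀ hq0,
    descWeight, descFact]
  simp only [tail]
  ring

/-- The recursion for the generating function of descending sequences. -/
lemma descSeries_eq_sumX (hq0 : q ≠ 0) (κ : ℕ → K) (N : ℕ → ℕ) :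
    descSeries q κ N = sumX fun s => PowerSeries.C (κ s * q ^ ((s : ℤ) ^ 2 - s * N 0)) *
      descSeries q (truncWeight q s) (fun t => N (t + 1)) := by
  ext n
  rw [coeff_sumX, descSeries, PowerSeries.coeff_mk]
  simp only [descWeight_eq hq0 N]
  rw [sum_level n fun s r => κ s * (q ^ ((s : ℤ) ^ 2 - s * N 0) *
      ((qFact q (s - r.1 0))⁻¹ * descWeight q (fun t => N (t + 1)) r))]
  refine sum_congr rfl fun p _ => ?_
  rw [PowerSeries.coeff_C_mul, descSeries, PowerSeries.coeff_mk, mul_sum]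
  refine sum_congr rfl fun r _ => ?_
  rw [truncWeight]
  split_ifs <;> ring

lemma descWeight_zero (N : ℕ → ℕ) : descWeight q N zero = 1 := by
  simp [descWeight, descFact, zero, qFact_zero]

lemma descSeries_truncWeight_head_zero (N : ℕ → ℕ) :
    descSeries q (truncWeight q 0) N = 1 := by
  ext n
  rw [descSeries, PowerSeries.coeff_mk, PowerSeries.coeff_one]
  split_ifs with hn
  · rw [hn, level_zero, sum_singleton, descWeight_zero]
    simp [truncWeight, zero, qFact_zero]
  · refine sum_eq_zero fun r hr => ?_
    have h : ¬ r.1 0 ≤ 0 := fun h => hn (by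
      rw [← mem_level.mp hr, eq_zero_of_head_eq_zero (Nat.le_zero.mp h), size_zero])
    rw [truncWeight, if_neg h, zero_mul]

lemma descSeries_truncWeight_zero (hq0 : q ≠ 0) (hq : ∀ n : ℕ, q ^ (n + 1) ≠ 1) (R : ℕ) :
    descSeries q (truncWeight q R) (fun _ => 0)
      = PowerSeries.C (qFact q R)⁻¹ * (xPoch q R)⁻¹ := by
  ext n
  induction n using Nat.strong_induction_on generalizing R with
  | _ n ih =>
    rw [descSeries_eq_sumX hq0, ← sumX_truncWeight hq, coeff_sumX, coeff_sumX]
    refine sum_congr rfl fun p hp => ?_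
    have hterm : ∀ s, PowerSeries.C (truncWeight q R s) * durfeeTerm q 0 s
        = PowerSeries.C (truncWeight q R s * q ^ ((s : ℤ) ^ 2 - s * (0 : ℕ))) *
          (PowerSeries.C (qFact q s)⁻¹ * (xPoch q s)⁻¹) := by
      intro s
      have : q ^ ((s : ℤ) ^ 2 - s * (0 : ℕ)) = q ^ (s ^ 2) := by
        rw [← zpow_natCast]; push_cast; ring_nf
      rw [this, durfeeTerm]
      simp only [map_mul, add_zero, zero_mul]
      ring
    rw [hterm, PowerSeries.coeff_C_mul, PowerSeries.coeff_C_mul]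
    congr 1
    obtain ⟨s, m⟩ := p
    rw [HasAntidiagonal.mem_antidiagonal] at hp
    rcases Nat.eq_zero_or_pos s with rfl | hs
    · simp [descSeries_truncWeight_head_zero, qFact_zero, xPoch]
    · exact ih m (by simp only at hp; omega) s

lemma descSeries_one_zero (hq0 : q ≠ 0) (hq : ∀ n : ℕ, q ^ (n + 1) ≠ 1) :
    descSeries q (fun _ => 1) (fun _ => 0) = qExp q := by
  rw [descSeries_eq_sumX hq0, ← sumX_durfeeTerm_zero hq]
  congr 1
  funext s
  have : q ^ ((s : ℤ) ^ 2 - s * (0 : ℕ)) = q ^ (s ^ 2) := by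
    rw [← zpow_natCast]; push_cast; ring_nf
  rw [descSeries_truncWeight_zero hq0 hq, this, durfeeTerm]
  simp only [map_mul, add_zero, zero_mul, one_mul]
  ring

/-- The identity satisfied by the generating function of descending sequences upon adding
an empty row. -/
def RowIdentity (q : K) (κ : ℕ → K) : Prop :=
  linFactor q 0 * linFactor q 1 * descSeries q κ (fun _ => 0)
    = linFactor q 0 * linFactor q 1 *
        PowerSeries.rescale q⁻¹ (descSeries q κ fun _ => 0)
      - PowerSeries.X * PowerSeries.rescale q (descSeries q (fun s => κ (s + 1)) fun _ => 0)

lemma rescale_rescale_inv (hq0 : q ≠ 0) (F : PowerSeries K) :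
    PowerSeries.rescale q (PowerSeries.rescale q⁻¹ F) = F := by
  rw [PowerSeries.rescale_rescale, inv_mul_cancel₀ hq0, PowerSeries.rescale_one]
  rfl

lemma rescale_injective (hq0 : q ≠ 0) :
    Function.Injective (PowerSeries.rescale q : PowerSeries K → PowerSeries K) := by
  intro F G h
  ext n
  have := congrArg (PowerSeries.coeff n) h
  rw [PowerSeries.coeff_rescale, PowerSeries.coeff_rescale] at this
  exact mul_left_cancel₀ (pow_ne_zero n hq0) this

lemma truncWeight_zero_succ (s : ℕ) : truncWeight q 0 (s + 1) = 0 := by simp [truncWeight]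

lemma truncWeight_succ_succ (R s : ℕ) : truncWeight q (R + 1) (s + 1) = truncWeight q R s := by
  simp [truncWeight]

lemma descSeries_zero_left (N : ℕ → ℕ) : descSeries q (fun _ => 0) N = 0 := by
  ext n; simp [descSeries]

lemma rowIdentity_truncWeight (hq0 : q ≠ 0) (hq : ∀ n : ℕ, q ^ (n + 1) ≠ 1) (R : ℕ) :
    RowIdentity q (truncWeight q R) := by
  cases R with
  | zero =>
    simp only [RowIdentity, truncWeight_zero_succ, descSeries_zero_left,
      descSeries_truncWeight_head_zero, map_one, map_zero]
    ring
  | succ R =>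
    apply rescale_injective hq0
    simp only [truncWeight_succ_succ, map_sub, map_mul, rescale_rescale_inv hq0,
      rescale_linFactor, descSeries_truncWeight_zero hq0 hq, rescale_C, rescale_xPoch_inv,
      PowerSeries.rescale_X]
    have h1 : PowerSeries.C (qFact q R)⁻¹
        = PowerSeries.C (1 - q ^ (R + 1)) * PowerSeries.C (qFact q (R + 1))⁻¹ := by
      have h2 : (1 - q ^ (R + 1)) ≠ 0 := sub_ne_zero.mpr (hq R).symm
      have h3 := qFact_ne_zero hq R
      rw [← map_mul, qFact_succ]
      congr 1
      field_simp
    rw [h1, xPoch_inv_eq q (R + 1)]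
    simp only [linFactor, map_sub, map_one, map_pow]
    ring

lemma rowIdentity_one (hq0 : q ≠ 0) (hq : ∀ n : ℕ, q ^ (n + 1) ≠ 1) :
    RowIdentity q (fun _ => 1) := by
  apply rescale_injective hq0
  simp only [map_sub, map_mul, rescale_rescale_inv hq0,
    rescale_linFactor, descSeries_one_zero hq0 hq, PowerSeries.rescale_X, rescale_qExp hq]
  simp only [linFactor, map_pow]
  ring

/-- Addition of a row of length `a`. -/
def addRow (a : ℕ) (N : ℕ → ℕ) (t : ℕ) : ℕ := if t < a then N t + 1 else N t

/-- The effect on the generating function of adding to `N` a row at least as long as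
all other rows. -/
lemma descSeries_addRow (hq0 : q ≠ 0) (hq : ∀ n : ℕ, q ^ (n + 1) ≠ 1) (a : ℕ) (N : ℕ → ℕ)
    (hN : ∀ t ≥ a, N t = 0) (κ : ℕ → K) (hκ : RowIdentity q κ) :
    linFactor q 0 * linFactor q 1 * descSeries q κ (addRow a N)
      = linFactor q 0 * linFactor q 1 * PowerSeries.rescale q⁻¹ (descSeries q κ N)
        - PowerSeries.C (q⁻¹ ^ ∑ t ∈ range a, N t) * PowerSeries.X ^ (a + 1) *
          PowerSeries.rescale q (descSeries q (fun s => κ (s + 1)) N) := by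
  induction a generalizing N κ with
  | zero =>
    obtain rfl : N = fun _ => 0 := funext fun t => hN t t.zero_le
    have : addRow 0 (fun _ => 0) = fun _ => 0 := rfl
    rw [this, hκ]
    simp
  | succ a ih =>
    have hhead : addRow (a + 1) N 0 = N 0 + 1 := by simp [addRow]
    have htail : (fun t => addRow (a + 1) N (t + 1)) = addRow a fun t => N (t + 1) := by
      funext t; simp [addRow]
    rw [descSeries_eq_sumX hq0 κ N, descSeries_eq_sumX hq0 _ N, descSeries_eq_sumX hq0, hhead,
      htail, rescale_sumX, rescale_sumX, mul_sumX, mul_sumX]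
    have hterm : ∀ s : ℕ, linFactor q 0 * linFactor q 1 *
          (PowerSeries.C (κ s * q ^ ((s : ℤ) ^ 2 - s * (N 0 + 1 : ℕ))) *
            descSeries q (truncWeight q s) (addRow a fun t => N (t + 1)))
        = linFactor q 0 * linFactor q 1 * (PowerSeries.C (q⁻¹ ^ s) * PowerSeries.rescale q⁻¹
            (PowerSeries.C (κ s * q ^ ((s : ℤ) ^ 2 - s * N 0)) *
              descSeries q (truncWeight q s) fun t => N (t + 1)))
          - PowerSeries.C (κ s * q ^ ((s : ℤ) ^ 2 - s * (N 0 + 1 : ℕ))) *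
            (PowerSeries.C (q⁻¹ ^ ∑ t ∈ range a, N (t + 1)) * PowerSeries.X ^ (a + 1) *
            PowerSeries.rescale q
              (descSeries q (fun s' => truncWeight q s (s' + 1)) fun t => N (t + 1))) := by
      intro s
      have hpow : q ^ ((s : ℤ) ^ 2 - s * (N 0 + 1 : ℕ))
          = q⁻¹ ^ s * q ^ ((s : ℤ) ^ 2 - s * N 0) := by
        rw [← zpow_natCast, inv_zpow', ← zpow_add₀ hq0]
        push_cast
        ring_nf
      rw [mul_left_comm, ih (fun t => N (t + 1)) (fun t ht => hN (t + 1) (by omega)) _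
        (rowIdentity_truncWeight hq0 hq s), hpow]
      simp only [map_mul, rescale_C]
      ring
    simp only [hterm]
    rw [sumX_sub]
    congr 1
    rw [sumX_eq_add]
    simp only [truncWeight_zero_succ, truncWeight_succ_succ, descSeries_zero_left, map_zero,
      mul_zero, zero_add]
    rw [mul_sumX, mul_sumX]
    congr 1
    funext s
    have hpow : q ^ (((s + 1 : ℕ) : ℤ) ^ 2 - (s + 1 : ℕ) * (N 0 + 1 : ℕ))
        = q⁻¹ ^ N 0 * q ^ s * q ^ ((s : ℤ) ^ 2 - s * N 0) := by
      rw [← zpow_natCast, ← zpow_natCast, inv_zpow', ← zpow_add₀ hq0, ← zpow_add₀ hq0]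
      push_cast
      ring_nf
    rw [hpow, sum_range_succ', pow_add q⁻¹]
    simp only [map_mul, rescale_C]
    ring

end DescendingSequences

section Palindromy

open Finset

variable {K : Type*} [Field K]

/-- The coefficients of a power series, extended by zero to integral exponents. -/
noncomputable def coeffInt (F : PowerSeries K) (k : ℤ) : K :=
  if 0 ≤ k then PowerSeries.coeff k.toNat F else 0

lemma coeffInt_natCast (F : PowerSeries K) (n : ℕ) : coeffInt F n = PowerSeries.coeff n F := by
  simp [coeffInt]

lemma coeffInt_of_neg (F : PowerSeries K) {k : ℤ} (hk : k < 0) : coeffInt F k = 0 :=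
  if_neg hk.not_ge

lemma coeffInt_sub (F G : PowerSeries K) (k : ℤ) :
    coeffInt (F - G) k = coeffInt F k - coeffInt G k := by
  unfold coeffInt; split_ifs <;> simp

lemma coeffInt_C_mul (c : K) (F : PowerSeries K) (k : ℤ) :
    coeffInt (PowerSeries.C c * F) k = c * coeffInt F k := by
  unfold coeffInt; split_ifs <;> simp

lemma coeffInt_X_pow_mul (F : PowerSeries K) (m : ℕ) (k : ℤ) :
    coeffInt (PowerSeries.X ^ m * F) k = coeffInt F (k - m) := by
  rcases lt_or_ge k 0 with hk | hk
  · rw [coeffInt_of_neg _ hk, coeffInt_of_neg _ (by omega)]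
  · lift k to ℕ using hk
    rw [coeffInt_natCast, PowerSeries.coeff_X_pow_mul']
    split_ifs with h
    · rw [← Nat.cast_sub h, coeffInt_natCast]
    · rw [coeffInt_of_neg _ (by omega)]

lemma coeffInt_rescale (c : K) (F : PowerSeries K) (k : ℤ) :
    coeffInt (PowerSeries.rescale c F) k = c ^ k * coeffInt F k := by
  rcases lt_or_ge k 0 with hk | hk
  · rw [coeffInt_of_neg _ hk, coeffInt_of_neg _ hk, mul_zero]
  · lift k to ℕ using hk
    rw [coeffInt_natCast, coeffInt_natCast, PowerSeries.coeff_rescale, zpow_natCast]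

lemma constantCoeff_qExp (q : K) : PowerSeries.constantCoeff (qExp q) = 1 := by
  rw [← PowerSeries.coeff_zero_eq_constantCoeff_apply, qExp, PowerSeries.coeff_mk]
  simp [qFact_zero]

lemma qExp_ne_zero (q : K) : qExp q ≠ 0 := fun h => by
  simpa [h] using constantCoeff_qExp q

lemma qExp_mul_inv (q : K) : qExp q * (qExp q)⁻¹ = 1 :=
  PowerSeries.mul_inv_cancel _ (by simp [constantCoeff_qExp])

/-- The quotient of the generating function of descending sequences by `1 / (qX;q)_∞`. -/
noncomputable def descQuot (q : K) (N : ℕ → ℕ) : PowerSeries K :=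
  descSeries q (fun _ => 1) N * (qExp q)⁻¹

lemma descQuot_mul_qExp (q : K) (N : ℕ → ℕ) :
    descQuot q N * qExp q = descSeries q (fun _ => 1) N := by
  rw [descQuot, mul_assoc, mul_comm _ (qExp q), qExp_mul_inv, mul_one]

variable {q : K}

lemma linFactor_mul_descQuot_addRow (hq0 : q ≠ 0) (hq : ∀ n : ℕ, q ^ (n + 1) ≠ 1) (a : ℕ)
    (N : ℕ → ℕ) (hN : ∀ t ≥ a, N t = 0) :
    linFactor q 0 * descQuot q (addRow a N) = PowerSeries.rescale q⁻¹ (descQuot q N)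
      - PowerSeries.C (q⁻¹ ^ ∑ t ∈ range a, N t) *
        (PowerSeries.X ^ (a + 1) * PowerSeries.rescale q (descQuot q N)) := by
  have h := descSeries_addRow hq0 hq a N hN _ (rowIdentity_one hq0 hq)
  have hL : PowerSeries.rescale q⁻¹ (linFactor q 1) = linFactor q 0 := by
    apply rescale_injective hq0
    rw [rescale_rescale_inv hq0, rescale_linFactor]
  have hφ : qExp q = linFactor q 0 * PowerSeries.rescale q⁻¹ (qExp q) := by
    rw [← hL, ← map_mul, ← rescale_qExp hq, PowerSeries.rescale_rescale, mul_inv_cancel₀ hq0,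
      PowerSeries.rescale_one]
    rfl
  simp only [← descQuot_mul_qExp, map_mul, rescale_qExp hq] at h
  apply mul_right_cancel₀ (mul_ne_zero (linFactor_ne_zero q 1) (qExp_ne_zero q))
  linear_combination h - linFactor q 1 * PowerSeries.rescale q⁻¹ (descQuot q N) * hφ

lemma coeffInt_descQuot_addRow (hq0 : q ≠ 0) (hq : ∀ n : ℕ, q ^ (n + 1) ≠ 1) (a : ℕ)
    (N : ℕ → ℕ) (hN : ∀ t ≥ a, N t = 0) (k : ℤ) :
    coeffInt (descQuot q (addRow a N)) k - coeffInt (descQuot q (addRow a N)) (k - 1)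
      = q ^ (-k) * coeffInt (descQuot q N) k
        - q ^ (k - (a + 1) - ∑ t ∈ range a, (N t : ℤ)) *
          coeffInt (descQuot q N) (k - (a + 1)) := by
  have h := congrArg (coeffInt · k) (linFactor_mul_descQuot_addRow hq0 hq a N hN)
  simp only [linFactor, pow_zero, map_one, one_mul, sub_mul, coeffInt_sub, coeffInt_C_mul,
    coeffInt_X_pow_mul, coeffInt_rescale] at h
  rw [← pow_one PowerSeries.X, coeffInt_X_pow_mul] at h
  push_cast at h
  rw [h, inv_zpow', ← zpow_natCast, inv_zpow', ← mul_assoc, ← zpow_add₀ hq0]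
  congr 3
  push_cast
  ring

/-- A sequence on the integers with antisymmetric differences is symmetric. -/
lemma symmetric_of_antisymmetric_diff [CharZero K] (p : ℤ → K) (d : ℤ)
    (h : ∀ k, p k - p (k - 1) = -(p (d + 1 - k) - p (d - k))) (k : ℤ) : p k = p (d - k) := by
  have hconst : ∀ k, p k - p (d - k) = p 0 - p d := by
    intro k
    induction k using Int.induction_on with
    | zero => simp
    | succ i ih =>
      have := h (i + 1)
      rw [add_sub_cancel_right, show d + 1 - ((i : ℤ) + 1) = d - i by ring] at this
      linear_combination ih + this
    | pred i ih =>
      have := h (-i)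
      rw [show d + 1 - -(i : ℤ) = d - (-i - 1) by ring] at this
      linear_combination ih - this
  have h1 := hconst k
  have h2 := hconst (d - k)
  rw [sub_sub_cancel] at h2
  have h3 : (2 : K) * (p k - p (d - k)) = 0 := by linear_combination h1 - h2
  exact sub_eq_zero.mp ((mul_eq_zero.mp h3).resolve_left two_ne_zero)

/-- The quotient series is palindromic of degree `∑ t, N t`. -/
lemma coeffInt_descQuot_symm [CharZero K] (hq0 : q ≠ 0) (hq : ∀ n : ℕ, q ^ (n + 1) ≠ 1)
    (N : ℕ → ℕ) (hN : Antitone N) (B : ℕ) (hB : ∀ t ≥ B, N t = 0) (k : ℤ) :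
    coeffInt (descQuot q N) k = coeffInt (descQuot q N) (∑ t ∈ range B, (N t : ℤ) - k) := by
  induction hn : N 0 generalizing N B k with
  | zero =>
    obtain rfl : N = fun _ => 0 := funext fun t => Nat.le_zero.mp (hn ▸ hN t.zero_le)
    have h1 : descQuot q (fun _ => 0) = 1 := by
      rw [descQuot, descSeries_one_zero hq0 hq, qExp_mul_inv]
    have h2 : ∀ k : ℤ, coeffInt (1 : PowerSeries K) k = if k = 0 then 1 else 0 := by
      intro k
      rcases lt_or_ge k 0 with hk | hk
      · rw [coeffInt_of_neg _ hk, if_neg hk.ne]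
      · lift k to ℕ using hk
        simp [coeffInt_natCast, PowerSeries.coeff_one]
    simp [h1, h2]
  | succ n ih =>
    have hex : ∃ t, N t = 0 := ⟨B, hB B le_rfl⟩
    classical
    set a := Nat.find hex with ha
    have hlt : ∀ t < a, N t ≠ 0 := fun t ht => Nat.find_min hex ht
    have hge : ∀ t ≥ a, N t = 0 := fun t ht =>
      Nat.le_zero.mp (Nat.find_spec hex ▸ hN ht)
    have hN' : ∀ t ≥ a, N t - 1 = 0 := fun t ht => by simp [hge t ht]
    have hrow : N = addRow a fun t => N t - 1 := by
      funext t
      unfold addRow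
      split_ifs with ht
      · have := hlt t ht
        simp only
        omega
      · have := hge t (not_lt.mp ht)
        simp only
        omega
    have hIH := fun k => ih (fun t => N t - 1)
      (fun s t hst => Nat.sub_le_sub_right (hN hst) 1) a hN' k (by simp [hn])
    have haB : a ≤ B := Nat.find_min' hex (hB B le_rfl)
    have hsum : ∑ t ∈ range B, (N t : ℤ) = ∑ t ∈ range a, ((N t - 1 : ℕ) : ℤ) + a := by
      rw [← sum_subset (range_subset_range.mpr haB) fun t _ ht => by
        simp [hge t (by simpa using ht)]]
      rw [sum_congr rfl fun t ht => show (N t : ℤ) = ((N t - 1 : ℕ) : ℤ) + 1 by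
        have := hlt t (mem_range.mp ht); omega]
      simp [sum_add_distrib]
    rw [hsum]
    rw [congrArg (descQuot q) hrow]
    refine symmetric_of_antisymmetric_diff _ _ (fun k => ?_) k
    have h1 := coeffInt_descQuot_addRow hq0 hq a _ hN' k
    set S := ∑ t ∈ range a, ((N t - 1 : ℕ) : ℤ) with hS
    have h2 := coeffInt_descQuot_addRow hq0 hq a _ hN' (S + a + 1 - k)
    rw [← hS, show S + a + 1 - k - 1 = S + a - k by ring,
      show S + a + 1 - k - (a + 1) = S - k by ring, ← hIH k,
      show S - k - S = -k by ring, show -(S + a + 1 - k) = k - (a + 1) - S by ring,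
      show S + a + 1 - k = S - (k - (a + 1)) by ring, ← hIH (k - (a + 1)),
      show S - (k - (a + 1)) = S + a + 1 - k by ring] at h2
    rw [h1, h2]
    ring

end Palindromy

section Reflections

open Finset

variable {I : Type*} [Fintype I] {K : Type*} [Field K]

/-- The coefficients of a power series, extended by zero to integral exponents. -/
noncomputable def mvCoeffInt (F : MvPowerSeries I K) (d : I → ℤ) : K :=
  if ∀ i, 0 ≤ d i then coeff (Finsupp.equivFunOnFinite.symm fun i => (d i).toNat) F else 0

lemma mvCoeffInt_natCast (F : MvPowerSeries I K) (n : I →₀ ℕ) :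
    mvCoeffInt F (fun i => (n i : ℤ)) = coeff n F := by
  rw [mvCoeffInt, if_pos fun i => Int.natCast_nonneg _]
  congr 2
  ext i
  simp

lemma mvCoeffInt_of_neg (F : MvPowerSeries I K) {d : I → ℤ} {i : I} (hi : d i < 0) :
    mvCoeffInt F d = 0 :=
  if_neg fun h => (h i).not_gt hi

lemma exists_natCast_eq {d : I → ℤ} (hd : ∀ i, 0 ≤ d i) :
    ∃ n : I →₀ ℕ, d = fun i => (n i : ℤ) :=
  ⟨Finsupp.equivFunOnFinite.symm fun i => (d i).toNat, funext fun i => by simp [hd i]⟩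

lemma mvCoeffInt_mul (F G : MvPowerSeries I K) (d : I → ℤ) :
    mvCoeffInt (F * G) d = ∑ᶠ a, mvCoeffInt F a * mvCoeffInt G (d - a) := by
  have hsupp : ∀ a, mvCoeffInt F a * mvCoeffInt G (d - a) ≠ 0 →
      (∀ i, 0 ≤ a i) ∧ ∀ i, 0 ≤ (d - a) i := by
    intro a ha
    refine ⟨fun i => ?_, fun i => ?_⟩ <;> by_contra hneg <;> apply ha
    · rw [mvCoeffInt_of_neg F (not_le.mp hneg), zero_mul]
    · rw [mvCoeffInt_of_neg G (not_le.mp hneg), mul_zero]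
  classical
  by_cases hd : ∀ i, 0 ≤ d i
  · obtain ⟨n, rfl⟩ := exists_natCast_eq hd
    rw [mvCoeffInt_natCast, coeff_mul,
      finsum_eq_sum_of_support_subset
      (s := (antidiagonal n).image fun p => (fun i => (p.1 i : ℤ)))]
    · rw [sum_image]
      · refine sum_congr rfl fun p hp => ?_
        rw [mvCoeffInt_natCast]
        congr 1
        rw [← mvCoeffInt_natCast]
        congr 1
        funext i
        rw [← HasAntidiagonal.mem_antidiagonal.mp hp]
        simp
      · intro p hp p' hp' h
        have h1 : p.1 = p'.1 := by
          ext i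
          exact Int.natCast_inj.mp (congrFun h i)
        have h2 := HasAntidiagonal.mem_antidiagonal.mp hp
        have h3 := HasAntidiagonal.mem_antidiagonal.mp hp'
        rw [h1, ← h3] at h2
        exact Prod.ext h1 (add_left_cancel h2)
    · intro a ha
      obtain ⟨h1, h2⟩ := hsupp a ha
      obtain ⟨m, rfl⟩ := exists_natCast_eq h1
      obtain ⟨m', hm'⟩ := exists_natCast_eq h2
      simp only [coe_image, Set.mem_image, mem_coe, HasAntidiagonal.mem_antidiagonal]
      refine ⟨(m, m'), ?_, rfl⟩
      ext i
      have := congrFun hm' i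
      simp only [Pi.sub_apply] at this
      simp only [Finsupp.add_apply]
      omega
  · rw [mvCoeffInt, if_neg hd, finsum_eq_zero_of_forall_eq_zero]
    intro a
    by_contra ha
    refine hd fun i => ?_
    have h1 := (hsupp a ha).1 i
    have h2 := (hsupp a ha).2 i
    simp only [Pi.sub_apply] at h2
    omega

/-- The power series `F(y ^ c)`. -/
noncomputable def substMonomial (c : I → ℕ) (F : PowerSeries K) : MvPowerSeries I K :=
  F.subst (monomial (Finsupp.equivFunOnFinite.symm c) (1 : K))

lemma hasSubst_monomial {c : I → ℕ} (hc : c ≠ 0) :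
    PowerSeries.HasSubst (monomial (Finsupp.equivFunOnFinite.symm c) (1 : K)) := by
  refine PowerSeries.HasSubst.monomial ?_ 1
  intro h
  exact hc (funext fun i => by simpa using DFunLike.congr_fun h i)

lemma substMonomial_mul {c : I → ℕ} (hc : c ≠ 0) (F G : PowerSeries K) :
    substMonomial c (F * G) = substMonomial c F * substMonomial c G :=
  PowerSeries.subst_mul (hasSubst_monomial hc) F G

lemma substMonomial_one {c : I → ℕ} (hc : c ≠ 0) :
    substMonomial c (1 : PowerSeries K) = 1 := by
  rw [substMonomial, ← PowerSeries.coe_substAlgHom (hasSubst_monomial hc), map_one]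

lemma mvCoeffInt_substMonomial {c : I → ℕ} (hc : c ≠ 0) (F : PowerSeries K) (d : I → ℤ) :
    mvCoeffInt (substMonomial c F) d
      = ∑ᶠ k : ℕ, if d = k • (fun i => (c i : ℤ)) then PowerSeries.coeff k F else 0 := by
  classical
  by_cases hd : ∀ i, 0 ≤ d i
  · obtain ⟨n, rfl⟩ := exists_natCast_eq hd
    rw [mvCoeffInt_natCast, substMonomial, PowerSeries.coeff_subst (hasSubst_monomial hc)]
    refine finsum_congr fun k => ?_
    rw [monomial_pow, one_pow, coeff_monomial]
    have : (n = k • Finsupp.equivFunOnFinite.symm c)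
        ↔ (fun i => (n i : ℤ)) = k • fun i => (c i : ℤ) := by
      simp only [Finsupp.ext_iff, funext_iff, Finsupp.smul_apply, Pi.smul_apply,
        Finsupp.equivFunOnFinite_symm_apply_apply]
      simp only [nsmul_eq_mul, smul_eq_mul]
      exact forall_congr' fun i => by norm_cast
    simp only [this, smul_eq_mul, mul_ite, mul_one, mul_zero]
  · rw [mvCoeffInt, if_neg hd, finsum_eq_zero_of_forall_eq_zero]
    intro k
    rw [if_neg]
    rintro rfl
    refine hd fun i => ?_
    simp only [Pi.smul_apply, nsmul_eq_mul]
    positivity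

lemma coeff_zero_substMonomial {c : I → ℕ} (hc : c ≠ 0) (F : PowerSeries K) :
    coeff 0 (substMonomial c F) = PowerSeries.constantCoeff F := by
  rw [← mvCoeffInt_natCast, mvCoeffInt_substMonomial hc, finsum_eq_single _ 0]
  · rw [if_pos, PowerSeries.coeff_zero_eq_constantCoeff_apply]
    funext j
    simp
  · intro k hk
    rw [if_neg]
    intro h
    apply hc
    funext j
    have := congrFun h j
    simp only [Pi.smul_apply] at this
    simpa [hk] using this

variable [DecidableEq I] (e : I → I → ℕ)

/-- The reflection on the root lattice of the graph with adjacency matrix `e`. -/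
def reflect (i : I) (d : I → ℤ) : I → ℤ := Function.update d i (∑ j, e i j * d j - d i)

variable {e}

lemma reflect_same (i : I) (d : I → ℤ) : reflect e i d i = ∑ j, e i j * d j - d i :=
  Function.update_self ..

lemma reflect_of_ne {i j : I} (h : j ≠ i) (d : I → ℤ) : reflect e i d j = d j :=
  Function.update_of_ne h ..

lemma reflect_reflect (he : ∀ i, e i i = 0) (i : I) (d : I → ℤ) :
    reflect e i (reflect e i d) = d := by
  have h : ∑ j, e i j * reflect e i d j = ∑ j, e i j * d j := by
    refine sum_congr rfl fun j _ => ?_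
    rcases eq_or_ne j i with rfl | hj
    · simp [he]
    · rw [reflect_of_ne hj]
  funext j
  rcases eq_or_ne j i with rfl | hj
  · rw [reflect_same, h, reflect_same, sub_sub_cancel]
  · rw [reflect_of_ne hj, reflect_of_ne hj]

lemma reflect_sub (i : I) (a b : I → ℤ) :
    reflect e i (a - b) = reflect e i a - reflect e i b := by
  funext j
  rcases eq_or_ne j i with rfl | hj
  · simp only [reflect_same, Pi.sub_apply, mul_sub, sum_sub_distrib]
    ring
  · simp only [reflect_of_ne hj, Pi.sub_apply]

lemma reflect_zero (i : I) : reflect e i 0 = 0 := by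
  simpa using reflect_sub (e := e) i 0 0

lemma reflect_nsmul (i : I) (k : ℕ) (a : I → ℤ) :
    reflect e i (k • a) = k • reflect e i a := by
  funext j
  rcases eq_or_ne j i with rfl | hj
  · simp only [reflect_same, Pi.smul_apply]
    simp only [nsmul_eq_mul, mul_sub, mul_sum]
    congr 1
    exact sum_congr rfl fun j _ => by ring
  · simp only [reflect_of_ne hj, Pi.smul_apply]

/-- The reflection as a permutation. -/
def reflectEquiv (he : ∀ i, e i i = 0) (i : I) : Equiv.Perm (I → ℤ) where
  toFun := reflect e i
  invFun := reflect e i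
  left_inv := reflect_reflect he i
  right_inv := reflect_reflect he i

/-- The coefficients of `G` are obtained from those of `F` by reflecting the exponents. -/
def IsReflection (e : I → I → ℕ) (i : I) (F G : MvPowerSeries I K) : Prop :=
  ∀ d, mvCoeffInt G (reflect e i d) = mvCoeffInt F d

lemma IsReflection.mul (he : ∀ i, e i i = 0) {i : I} {F G F' G' : MvPowerSeries I K}
    (h : IsReflection e i F G) (h' : IsReflection e i F' G') :
    IsReflection e i (F * F') (G * G') := by
  intro d
  rw [mvCoeffInt_mul, mvCoeffInt_mul, ← finsum_comp_equiv (reflectEquiv he i)]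
  refine finsum_congr fun a => ?_
  have hr : reflectEquiv he i a = reflect e i a := rfl
  rw [hr, ← reflect_sub, h, h']

lemma isReflection_one (he : ∀ i, e i i = 0) (i : I) :
    IsReflection e i (1 : MvPowerSeries I K) 1 := by
  have h1 : ∀ d : I → ℤ, mvCoeffInt (1 : MvPowerSeries I K) d = if d = 0 then 1 else 0 := by
    intro d
    by_cases hd : ∀ i, 0 ≤ d i
    · obtain ⟨n, rfl⟩ := exists_natCast_eq hd
      rw [mvCoeffInt_natCast, coeff_one]
      congr 1
      simp [funext_iff, Finsupp.ext_iff]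
    · rw [mvCoeffInt, if_neg hd, if_neg]
      rintro rfl
      exact hd fun _ => le_rfl
  intro d
  have : reflect e i d = 0 ↔ d = 0 :=
    ⟨fun h => by rw [← reflect_reflect he i d, h, reflect_zero], fun h => by rw [h, reflect_zero]⟩
  simp only [h1, this]

lemma IsReflection.prod (he : ∀ i, e i i = 0) {i : I} {α : Type*} (s : Finset α)
    {F G : α → MvPowerSeries I K} (h : ∀ c ∈ s, IsReflection e i (F c) (G c)) :
    IsReflection e i (∏ c ∈ s, F c) (∏ c ∈ s, G c) := by
  classical
  induction s using Finset.induction_on with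
  | empty => simpa using isReflection_one he i
  | insert a s ha ih =>
    rw [prod_insert ha, prod_insert ha]
    exact (h a (mem_insert_self a s)).mul he (ih fun c hc => h c (mem_insert_of_mem hc))

lemma isReflection_substMonomial (he : ∀ i, e i i = 0) {i : I} {c c' : I → ℕ} (hc : c ≠ 0)
    (hc' : c' ≠ 0) (h : (fun j => (c' j : ℤ)) = reflect e i fun j => (c j : ℤ))
    (F : PowerSeries K) : IsReflection e i (substMonomial c F) (substMonomial c' F) := by
  intro d
  rw [mvCoeffInt_substMonomial hc, mvCoeffInt_substMonomial hc']
  refine finsum_congr fun k => ?_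
  rw [h, ← reflect_nsmul]
  congr 1
  exact propext (reflectEquiv he i).injective.eq_iff

/-- A power series which is invariant under all reflections is constant, provided that every
nonzero exponent is lowered by some reflection. -/
lemma eq_one_of_isReflection (he : ∀ i, e i i = 0)
    (hpos : ∀ d : I → ℤ, (∀ i, 0 ≤ d i) → d ≠ 0 → ∃ i, ∑ j, e i j * d j < 2 * d i)
    {F : MvPowerSeries I K} (hF : ∀ i, IsReflection e i F F) (h0 : coeff 0 F = 1) : F = 1 := by
  have key : ∀ m : ℕ, ∀ d : I → ℤ, d ≠ 0 → (∑ i, d i).toNat = m → mvCoeffInt F d = 0 := by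
    intro m
    induction m using Nat.strong_induction_on with
    | _ m ih =>
      intro d hd hm
      by_cases hneg : ∀ i, 0 ≤ d i
      · obtain ⟨i, hi⟩ := hpos d hneg hd
        rw [← hF i d]
        by_cases hneg' : ∀ j, 0 ≤ reflect e i d j
        · have hsum : ∑ j, reflect e i d j < ∑ j, d j := by
            refine sum_lt_sum (fun j _ => ?_) ⟨i, mem_univ i, ?_⟩
            · rcases eq_or_ne j i with rfl | hj
              · rw [reflect_same]; omega
              · rw [reflect_of_ne hj]
            · rw [reflect_same]; omega
          have hnn : 0 ≤ ∑ j, reflect e i d j := sum_nonneg fun j _ => hneg' j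
          by_cases hzero : reflect e i d = 0
          · exact absurd (by rw [← reflect_reflect he i d, hzero, reflect_zero]) hd
          · exact ih _ (by omega) _ hzero rfl
        · rw [mvCoeffInt, if_neg hneg']
      · rw [mvCoeffInt, if_neg hneg]
  ext n
  rw [coeff_one]
  split_ifs with hn
  · rw [hn, h0]
  · rw [← mvCoeffInt_natCast]
    refine key _ _ (fun h => hn ?_) rfl
    ext i
    simpa using congrFun h i

end Reflections

section QuiverSeries

open Finset DescSeq

variable {I : Type*} [Fintype I] {K : Type*} [Field K]

/-- The sum of the neighbouring sequences. -/
def neighborSum (e : I → I → ℕ) (i : I) (r : I → DescSeq) (t : ℕ) : ℕ := ∑ j, e i j * (r j).1 t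

lemma antitone_neighborSum (e : I → I → ℕ) (i : I) (r : I → DescSeq) :
    Antitone (neighborSum e i r) := fun _ _ h =>
  sum_le_sum fun j _ => Nat.mul_le_mul_left _ ((r j).2.1 h)

lemma exists_bound (r : I → DescSeq) : ∃ B, ∀ t ≥ B, ∀ j, (r j).1 t = 0 := by
  choose B hB using fun j => (r j).2.2
  exact ⟨univ.sup B, fun t ht j => hB j t ((le_sup (mem_univ j)).trans ht)⟩

variable [DecidableEq I]

/-- Descending tuples with prescribed sizes, split off along one coordinate. -/
lemma sum_piFinset_level {M : Type*} [AddCommMonoid M] (n : I → ℕ) (i : I)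
    (h : (I → DescSeq) → M) :
    ∑ r ∈ Fintype.piFinset fun j => level (n j), h r
      = ∑ r ∈ Fintype.piFinset fun j => level (Function.update n i 0 j), ∑ v ∈ level (n i),
          h (Function.update r i v) := by
  rw [← sum_product']
  refine sum_bij' (i := fun r _ => (Function.update r i zero, r i))
    (j := fun p _ => Function.update p.1 i p.2) ?_ ?_ ?_ ?_ ?_
  · intro r hr
    simp only [Fintype.mem_piFinset, mem_level, mem_product] at hr ⊢
    refine ⟨fun j => ?_, hr i⟩
    rcases eq_or_ne j i with rfl | hj
    · simp [size_zero]
    · simp [hj, hr j]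
  · rintro ⟨r, v⟩ hr
    simp only [Fintype.mem_piFinset, mem_level, mem_product] at hr ⊢
    intro j
    rcases eq_or_ne j i with rfl | hj
    · simp [hr.2]
    · simpa [hj] using hr.1 j
  · intro r _
    simp
  · rintro ⟨r, v⟩ hr
    simp only [Fintype.mem_piFinset, mem_level, mem_product] at hr
    have h0 : r i = zero := size_eq_zero_iff.mp (by simpa using hr.1 i)
    simp [← h0]
  · intro r _
    simp

/-- The functional `E` depends on each of its arguments as prescribed by the graph with
adjacency matrix `e`. -/
structure IsQuiverForm (e : I → I → ℕ) (E : (I → DescSeq) → ℤ) : Prop where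
  zero : E (fun _ => zero) = 0
  update : ∀ (r : I → DescSeq) (i : I) (v : DescSeq), r i = DescSeq.zero →
    E (Function.update r i v) = E r + ∑ᶠ t, ((v.1 t : ℤ) ^ 2 - v.1 t * neighborSum e i r t)

/-- The weight of a tuple of descending sequences. -/
noncomputable def quiverWeight (q : K) (E : (I → DescSeq) → ℤ) (r : I → DescSeq) : K :=
  q ^ E r * ∏ i, descFact q (r i).1

/-- The generating function of tuples of descending sequences. -/
noncomputable def quiverSeries (q : K) (E : (I → DescSeq) → ℤ) : MvPowerSeries I K :=
  fun n => ∑ r ∈ Fintype.piFinset fun j => level (n j), quiverWeight q E r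

lemma coeff_quiverSeries (q : K) (E : (I → DescSeq) → ℤ) (n : I →₀ ℕ) :
    coeff n (quiverSeries q E)
      = ∑ r ∈ Fintype.piFinset fun j => level (n j), quiverWeight q E r := rfl

variable {q : K} {e : I → I → ℕ} {E : (I → DescSeq) → ℤ}

lemma descFact_zero : descFact q zero.1 = 1 := by simp [descFact, zero, qFact_zero]

lemma quiverWeight_update (hq0 : q ≠ 0) (hE : IsQuiverForm e E) (r : I → DescSeq) (i : I)
    (v : DescSeq) (hr : r i = zero) :
    quiverWeight q E (Function.update r i v)
      = quiverWeight q E r * descWeight q (neighborSum e i r) v := by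
  have h1 : ∏ j, descFact q (Function.update r i v j).1
      = descFact q v.1 * ∏ j, descFact q (r j).1 := by
    rw [← mul_prod_erase univ _ (mem_univ i), ← mul_prod_erase univ
      (fun j => descFact q (r j).1) (mem_univ i), hr, descFact_zero, one_mul,
      Function.update_self]
    congr 1
    refine prod_congr rfl fun j hj => ?_
    rw [Function.update_of_ne (ne_of_mem_erase hj)]
  rw [quiverWeight, hE.update r i v hr, zpow_add₀ hq0, h1, quiverWeight, descWeight]
  ring

lemma sum_quiverWeight (hq0 : q ≠ 0) (hE : IsQuiverForm e E) (n : I → ℕ) (i : I) :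
    ∑ r ∈ Fintype.piFinset fun j => level (n j), quiverWeight q E r
      = ∑ r ∈ Fintype.piFinset fun j => level (Function.update n i 0 j), quiverWeight q E r *
          PowerSeries.coeff (n i) (descSeries q (fun _ => 1) (neighborSum e i r)) := by
  rw [sum_piFinset_level n i]
  refine sum_congr rfl fun r hr => ?_
  have h0 : r i = zero := size_eq_zero_iff.mp (by
    simpa [mem_level] using Fintype.mem_piFinset.mp hr i)
  rw [descSeries, PowerSeries.coeff_mk, mul_sum]
  refine sum_congr rfl fun v _ => ?_
  rw [quiverWeight_update hq0 hE r i v h0, one_mul]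

lemma coeff_substMonomial_single (i : I) (F : PowerSeries K) (n : I →₀ ℕ) :
    coeff n (substMonomial (Pi.single i 1) F)
      = if n = Finsupp.single i (n i) then PowerSeries.coeff (n i) F else 0 := by
  have hc : (Pi.single i 1 : I → ℕ) ≠ 0 := by simp
  have h1 : Finsupp.equivFunOnFinite.symm (Pi.single i 1 : I → ℕ) = Finsupp.single i 1 := by
    simp
  rw [substMonomial, PowerSeries.coeff_subst (hasSubst_monomial hc), h1,
    finsum_eq_single _ (n i)]
  · rw [monomial_pow, one_pow, coeff_monomial]
    simp
  · intro k hk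
    rw [monomial_pow, one_pow, coeff_monomial, if_neg, smul_zero]
    rintro rfl
    simp at hk

/-- The coefficients of the product of the generating function with `1 / F(y_i)`. -/
lemma mvCoeffInt_quiverSeries_mul (hq0 : q ≠ 0) (hE : IsQuiverForm e E) (i : I) (n : I →₀ ℕ)
    (k : ℤ) :
    mvCoeffInt (quiverSeries q E * substMonomial (Pi.single i 1) (qExp q)⁻¹)
        (Function.update (fun j => (n j : ℤ)) i k)
      = ∑ r ∈ Fintype.piFinset fun j => level (Function.update n i 0 j), quiverWeight q E r *
          coeffInt (descQuot q (neighborSum e i r)) k := by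
  rcases lt_or_ge k 0 with hk | hk
  · rw [mvCoeffInt_of_neg _ (i := i) (by simpa using hk)]
    simp [coeffInt_of_neg _ hk]
  lift k to ℕ using hk
  have hn : Function.update (fun j => (n j : ℤ)) i (k : ℤ) = fun j => ((n.update i k j : ℕ) : ℤ) := by
    funext j
    rcases eq_or_ne j i with rfl | hj
    · simp
    · simp [hj]
  rw [hn, mvCoeffInt_natCast, coeff_mul]
  simp only [coeffInt_natCast, descQuot, PowerSeries.coeff_mul, mul_sum]
  rw [sum_comm]
  symm
  refine sum_of_injOn (fun p => (n.update i p.1, Finsupp.single i p.2)) ?_ ?_ ?_ ?_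
  · intro p _ p' _ h
    have h1 := DFunLike.congr_fun (congrArg Prod.fst h) i
    have h2 := DFunLike.congr_fun (congrArg Prod.snd h) i
    simp only [Finsupp.update_apply, Finsupp.single_eq_same, if_true] at h1 h2
    exact Prod.ext h1 h2
  · intro p hp
    simp only [mem_coe, HasAntidiagonal.mem_antidiagonal] at hp ⊢
    ext j
    rcases eq_or_ne j i with rfl | hj
    · simp [hp]
    · simp [hj]
  · rintro ⟨a, b⟩ hab hnot
    rw [HasAntidiagonal.mem_antidiagonal] at hab
    rw [coeff_substMonomial_single, if_neg, mul_zero]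
    intro hb
    apply hnot
    refine ⟨(a i, b i), ?_, ?_⟩
    · simpa using DFunLike.congr_fun hab i
    · refine Prod.ext ?_ hb.symm
      ext j
      rcases eq_or_ne j i with rfl | hj
      · simp
      · have := DFunLike.congr_fun hab j
        rw [hb] at this
        simpa [hj] using this.symm
  · rintro ⟨a, b⟩ _
    rw [coeff_substMonomial_single, coeff_quiverSeries, sum_quiverWeight hq0 hE _ i]
    have h0 : Function.update (⇑(n.update i a)) i 0 = Function.update (⇑n) i 0 := by
      funext j
      rcases eq_or_ne j i with rfl | hj
      · simp
      · simp [hj]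
    simp only [h0, sum_mul, Finsupp.single_eq_same, if_true, Finsupp.update_apply]
    exact sum_congr rfl fun r _ => by ring

/-- The reflection symmetry of the generating function. -/
lemma isReflection_quiverSeries [CharZero K] (hq0 : q ≠ 0) (hq : ∀ n : ℕ, q ^ (n + 1) ≠ 1)
    (he : ∀ i, e i i = 0) (hE : IsQuiverForm e E) (i : I) :
    IsReflection e i (quiverSeries q E * substMonomial (Pi.single i 1) (qExp q)⁻¹)
      (quiverSeries q E * substMonomial (Pi.single i 1) (qExp q)⁻¹) := by
  intro d
  by_cases hd : ∀ j, j ≠ i → 0 ≤ d j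
  · obtain ⟨n, hn⟩ := exists_natCast_eq (d := Function.update d i 0) (fun j => by
      rcases eq_or_ne j i with rfl | hj
      · simp
      · simpa [hj] using hd j hj)
    have h1 : ∀ k, Function.update d i k = Function.update (fun j => (n j : ℤ)) i k := by
      intro k
      rw [← hn, Function.update_idem]
    conv_rhs => rw [← Function.update_eq_self i d, h1, mvCoeffInt_quiverSeries_mul hq0 hE]
    rw [reflect, h1, mvCoeffInt_quiverSeries_mul hq0 hE]
    refine sum_congr rfl fun r hr => ?_
    congr 1
    obtain ⟨B, hB⟩ := exists_bound r
    rw [coeffInt_descQuot_symm hq0 hq _ (antitone_neighborSum e i r) B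
      (fun t ht => sum_eq_zero fun j _ => by rw [hB t ht, mul_zero]) (d i)]
    congr 2
    simp only [neighborSum, Nat.cast_sum]
    rw [sum_comm]
    refine sum_congr rfl fun j _ => ?_
    rcases eq_or_ne j i with rfl | hj
    · simp [he]
    · have hs := mem_level.mp (Fintype.mem_piFinset.mp hr j)
      rw [Function.update_of_ne hj, DescSeq.size,
        finsum_eq_sum_range (B := B) fun t ht => hB t ht j] at hs
      have hdj : d j = n j := by simpa [hj] using congrFun hn j
      rw [hdj, ← hs]
      push_cast
      rw [mul_sum]
  · push Not at hd
    obtain ⟨j, hj, hneg⟩ := hd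
    rw [mvCoeffInt_of_neg _ hneg, mvCoeffInt_of_neg _ (i := j) (by rwa [reflect_of_ne hj])]

/-- A finite set of exponents behaves like the set of positive roots of the graph with
adjacency matrix `e`. -/
structure IsPositiveRoots (e : I → I → ℕ) (Φ : Finset (I → ℕ)) : Prop where
  ne_zero : ∀ c ∈ Φ, c ≠ 0
  single_mem : ∀ i, Pi.single i 1 ∈ Φ
  reflect_mem : ∀ i, ∀ c ∈ Φ, c ≠ Pi.single i 1 →
    ∃ c' ∈ Φ, (fun j => (c' j : ℤ)) = reflect e i fun j => (c j : ℤ)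

lemma isReflection_prod_erase (he : ∀ i, e i i = 0) {Φ : Finset (I → ℕ)}
    (hΦ : IsPositiveRoots e Φ) (F : PowerSeries K) (i : I) :
    IsReflection e i (∏ c ∈ Φ.erase (Pi.single i 1), substMonomial c F)
      (∏ c ∈ Φ.erase (Pi.single i 1), substMonomial c F) := by
  have hex : ∀ c ∈ Φ.erase (Pi.single i 1), ∃ c' ∈ Φ.erase (Pi.single i 1),
      (fun j => (c' j : ℤ)) = reflect e i fun j => (c j : ℤ) := by
    intro c hc
    obtain ⟨c', h1, h2⟩ := hΦ.reflect_mem i c (mem_of_mem_erase hc) (ne_of_mem_erase hc)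
    refine ⟨c', mem_erase.mpr ⟨?_, h1⟩, h2⟩
    rintro rfl
    have h3 := congrFun (congrArg (reflect e i) h2) i
    rw [reflect_reflect he, reflect_same, sum_eq_zero] at h3
    · simp only [Pi.single_eq_same, Nat.cast_one] at h3
      omega
    · intro j _
      rcases eq_or_ne j i with rfl | hj
      · simp [he]
      · simp [hj]
  choose! σ hσ hσr using hex
  have hprod : ∏ c ∈ Φ.erase (Pi.single i 1), substMonomial c F
      = ∏ c ∈ Φ.erase (Pi.single i 1), substMonomial (σ c) F := by
    have hinv : ∀ c ∈ Φ.erase (Pi.single i 1), σ (σ c) = c := by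
      intro c hc
      have h := hσr _ (hσ c hc)
      rw [hσr c hc, reflect_reflect he] at h
      funext j
      exact_mod_cast congrFun h j
    exact (prod_nbij' σ σ hσ hσ hinv hinv fun _ _ => rfl).symm
  conv => arg 4; rw [hprod]
  refine IsReflection.prod he _ fun c hc => ?_
  exact isReflection_substMonomial he (hΦ.ne_zero c (mem_of_mem_erase hc))
    (hΦ.ne_zero _ (mem_of_mem_erase (hσ c hc))) (hσr c hc) F

/-- The product formula for the generating function of tuples of descending sequences. -/
theorem quiverSeries_eq_prod [CharZero K] (hq0 : q ≠ 0) (hq : ∀ n : ℕ, q ^ (n + 1) ≠ 1)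
    (he : ∀ i, e i i = 0) (hE : IsQuiverForm e E)
    (hpos : ∀ d : I → ℤ, (∀ i, 0 ≤ d i) → d ≠ 0 → ∃ i, ∑ j, e i j * d j < 2 * d i)
    {Φ : Finset (I → ℕ)} (hΦ : IsPositiveRoots e Φ) :
    quiverSeries q E = ∏ c ∈ Φ, substMonomial c (qExp q) := by
  have h1 : quiverSeries q E * ∏ c ∈ Φ, substMonomial c (qExp q)⁻¹ = 1 := by
    refine eq_one_of_isReflection he hpos (fun i => ?_) ?_
    · rw [← mul_prod_erase Φ _ (hΦ.single_mem i), ← mul_assoc]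
      exact (isReflection_quiverSeries hq0 hq he hE i).mul he
        (isReflection_prod_erase he hΦ _ i)
    · rw [coeff_zero_eq_constantCoeff_apply, map_mul, map_prod, prod_eq_one, mul_one,
        ← coeff_zero_eq_constantCoeff_apply, coeff_quiverSeries]
      · have : (Fintype.piFinset fun j : I => level ((0 : I →₀ ℕ) j)) = {fun _ => zero} := by
          ext r
          simp [level_zero, funext_iff]
        rw [this, sum_singleton, quiverWeight, hE.zero]
        simp [descFact_zero]
      · intro c hc
        rw [← coeff_zero_eq_constantCoeff_apply, coeff_zero_substMonomial (hΦ.ne_zero c hc)]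
        simp [constantCoeff_qExp]
  have h2 : (∏ c ∈ Φ, substMonomial c (qExp q)⁻¹) * ∏ c ∈ Φ, substMonomial c (qExp q) = 1 := by
    rw [← prod_mul_distrib]
    refine prod_eq_one fun c hc => ?_
    rw [← substMonomial_mul (hΦ.ne_zero c hc), mul_comm, qExp_mul_inv,
      substMonomial_one (hΦ.ne_zero c hc)]
  rw [← mul_one (quiverSeries q E), ← h2, ← mul_assoc, h1, one_mul]

end QuiverSeries

section RootSystem

open Finset DescSeq

/-- The adjacency matrix of the Dynkin diagram of type `E₈`. -/
def adjE8 (i j : Fin 8) : ℕ := (-cartanE8 i j).toNat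

lemma adjE8_self (i : Fin 8) : adjE8 i i = 0 := by revert i; decide

/-- Half the quadratic form of type `E₈`. -/
def formE8 (d : Fin 8 → ℤ) : ℤ :=
  ∑ i, d i ^ 2 - (d 0 * d 1 + d 1 * d 2 + d 2 * d 3 + d 3 * d 4 + d 4 * d 5 + d 5 * d 6
    + d 4 * d 7)

lemma sum_cartanE8 (d : Fin 8 → ℤ) :
    ∑ i, ∑ j, d i * cartanE8 i j * d j = 2 * formE8 d := by
  simp only [formE8, Fin.sum_univ_eight, cartanE8, Matrix.of_apply, Matrix.cons_val]
  ring

lemma sum_adjE8 (d : Fin 8 → ℤ) (i : Fin 8) :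
    ∑ j, adjE8 i j * d j = ![d 1, d 0 + d 2, d 1 + d 3, d 2 + d 4, d 3 + d 5 + d 7, d 4 + d 6,
      d 5, d 4] i := by
  have h : ∀ i j, adjE8 i j = if cartanE8 i j = -1 then 1 else 0 := by decide
  fin_cases i <;> simp [h, Fin.sum_univ_eight, cartanE8] 

lemma formE8_update (d : Fin 8 → ℤ) (i : Fin 8) (v : ℤ) :
    formE8 (Function.update d i v)
      = formE8 (Function.update d i 0) + (v ^ 2 - v * ∑ j, adjE8 i j * d j) := by
  rw [sum_adjE8]
  fin_cases i <;> simp [formE8, Fin.sum_univ_eight, Function.update_apply] <;> ring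

lemma formE8_eq_sum_sq (d : Fin 8 → ℤ) :
    120 * formE8 d = 30 * (2 * d 0 - d 1) ^ 2 + 10 * (3 * d 1 - 2 * d 2) ^ 2
      + 5 * (4 * d 2 - 3 * d 3) ^ 2 + 3 * (5 * d 3 - 4 * d 4) ^ 2 + 30 * (2 * d 6 - d 5) ^ 2
      + 10 * (3 * d 5 - 2 * d 4) ^ 2 + 30 * (2 * d 7 - d 4) ^ 2 + 2 * d 4 ^ 2 := by
  simp only [formE8, Fin.sum_univ_eight]
  ring

lemma formE8_nonneg (d : Fin 8 → ℤ) : 0 ≤ formE8 d := by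
  have h := formE8_eq_sum_sq d
  have : 0 ≤ 120 * formE8 d := by rw [h]; positivity
  omega

lemma eq_zero_of_formE8_nonpos {d : Fin 8 → ℤ} (hd : formE8 d ≤ 0) : d = 0 := by
  have h := formE8_eq_sum_sq d
  have h0 := sq_nonneg (2 * d 0 - d 1)
  have h1 := sq_nonneg (3 * d 1 - 2 * d 2)
  have h2 := sq_nonneg (4 * d 2 - 3 * d 3)
  have h3 := sq_nonneg (5 * d 3 - 4 * d 4)
  have h4 := sq_nonneg (2 * d 6 - d 5)
  have h5 := sq_nonneg (3 * d 5 - 2 * d 4)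
  have h6 := sq_nonneg (2 * d 7 - d 4)
  have h7 := sq_nonneg (d 4)
  have sq0 : ∀ x : ℤ, x ^ 2 ≤ 0 → x = 0 := fun x hx =>
    pow_eq_zero_iff two_ne_zero |>.mp (le_antisymm hx (sq_nonneg x))
  have e0 := sq0 (2 * d 0 - d 1) (by linarith)
  have e1 := sq0 (3 * d 1 - 2 * d 2) (by linarith)
  have e2 := sq0 (4 * d 2 - 3 * d 3) (by linarith)
  have e3 := sq0 (5 * d 3 - 4 * d 4) (by linarith)
  have e4 := sq0 (2 * d 6 - d 5) (by linarith)
  have e5 := sq0 (3 * d 5 - 2 * d 4) (by linarith)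
  have e6 := sq0 (2 * d 7 - d 4) (by linarith)
  have e7 := sq0 (d 4) (by linarith)
  funext i
  fin_cases i <;> simp only [Fin.reduceFinMk, Pi.zero_apply, Fin.zero_eta, Fin.mk_one] <;> omega

lemma exists_sum_adjE8_lt (d : Fin 8 → ℤ) (hd : ∀ i, 0 ≤ d i) (h0 : d ≠ 0) :
    ∃ i, ∑ j, adjE8 i j * d j < 2 * d i := by
  by_contra! h
  simp only [sum_adjE8] at h
  have h0' := h 0
  have h1 := h 1
  have h2 := h 2
  have h3 := h 3
  have h4 := h 4
  have h5 := h 5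
  have h6 := h 6
  have h7 := h 7
  simp only [Matrix.cons_val] at h0' h1 h2 h3 h4 h5 h6 h7
  refine h0 (funext fun i => le_antisymm ?_ (hd i))
  fin_cases i <;> simp only [Fin.reduceFinMk, Pi.zero_apply, Fin.zero_eta, Fin.mk_one] <;> linarith

lemma formE8_reflect (i : Fin 8) (d : Fin 8 → ℤ) : formE8 (reflect adjE8 i d) = formE8 d := by
  conv_rhs => rw [← Function.update_eq_self i d, formE8_update]
  rw [reflect, formE8_update]
  ring

/-- The simple reflection permutes the positive roots other than the simple root. -/
lemma reflect_nonneg {c : Fin 8 → ℕ} (hc : formE8 (fun j => c j) = 1) {i : Fin 8}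
    (hi : c ≠ Pi.single i 1) (j : Fin 8) : 0 ≤ reflect adjE8 i (fun j => (c j : ℤ)) j := by
  rcases ne_or_eq j i with hj | rfl
  · rw [reflect_of_ne hj]
    positivity
  rw [reflect_same]
  by_contra! hneg
  set S := ∑ k, (adjE8 j k : ℤ) * c k with hS
  have hS0 : 0 ≤ S := sum_nonneg fun _ _ => by positivity
  have h1 := formE8_update (fun k => (c k : ℤ)) j (c j)
  rw [Function.update_eq_self j fun k => (c k : ℤ), hc, ← hS] at h1
  have h2 : Function.update (fun k => (c k : ℤ)) j 0 = 0 :=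
    eq_zero_of_formE8_nonpos (by nlinarith)
  have h3 : ∀ k, k ≠ j → c k = 0 := fun k hk => by simpa [hk] using congrFun h2 k
  have h4 : S = 0 := by
    refine sum_eq_zero fun k _ => ?_
    rcases eq_or_ne k j with rfl | hk
    · simp [adjE8_self]
    · simp [h3 k hk]
  have h5 : formE8 0 = 0 := by simp [formE8]
  rw [h2, h5, h4] at h1
  have h6 : c j = 1 := by
    have : (c j : ℤ) ^ 2 = 1 := by linarith
    have : c j ^ 2 = 1 := by exact_mod_cast this
    simpa using this
  refine hi (funext fun k => ?_)
  rcases eq_or_ne k j with rfl | hk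
  · simp [h6]
  · simp [h3 k hk, hk]

lemma formE8_single (i : Fin 8) : formE8 (fun j => ((Pi.single i 1 : Fin 8 → ℕ) j : ℤ)) = 1 := by
  revert i; decide

variable {Φ : Finset (Fin 8 → ℕ)}

lemma exists_reflect_mem (hΦ : ∀ c : Fin 8 → ℕ, c ∈ Φ ↔ formE8 (fun j => c j) = 1) {i : Fin 8}
    {c : Fin 8 → ℕ} (hc : c ∈ Φ) (hi : c ≠ Pi.single i 1) :
    ∃ c' ∈ Φ, (fun j => (c' j : ℤ)) = reflect adjE8 i fun j => (c j : ℤ) := by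
  rw [hΦ] at hc
  obtain ⟨c', hc'⟩ := exists_natCast_eq (reflect_nonneg hc hi)
  exact ⟨c', (hΦ _).mpr (by rw [← hc', formE8_reflect, hc]), hc'.symm⟩

lemma isPositiveRoots_adjE8 (hΦ : ∀ c : Fin 8 → ℕ, c ∈ Φ ↔ formE8 (fun j => c j) = 1) :
    IsPositiveRoots adjE8 Φ where
  ne_zero c hc := by
    rintro rfl
    simp [hΦ, formE8] at hc
  single_mem i := (hΦ _).mpr (formE8_single i)
  reflect_mem _ _ hc hi := exists_reflect_mem hΦ hc hi

/-- The positive roots of type `E₈`, with coordinates written as decimal digits. -/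
def rootCodes : List ℕ :=
  [1, 10, 100, 110, 1000, 1001, 1100, 1101, 1110, 1111, 10000, 11000, 11001, 11100, 11101, 11110,
    11111, 12101, 12111, 12211, 100000, 110000, 111000, 111001, 111100, 111101, 111110, 111111,
    112101, 112111, 112211, 122101, 122111, 122211, 123211, 123212, 1000000, 1100000, 1110000,
    1111000, 1111001, 1111100, 1111101, 1111110, 1111111, 1112101, 1112111, 1112211, 1122101,
    1122111, 1122211, 1123211, 1123212, 1222101, 1222111, 1222211, 1223211, 1223212, 1233211,
    1233212, 1234212, 1234312, 1234322, 10000000, 11000000, 11100000, 11110000, 11111000,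
    11111001, 11111100, 11111101, 11111110, 11111111, 11112101, 11112111, 11112211, 11122101,
    11122111, 11122211, 11123211, 11123212, 11222101, 11222111, 11222211, 11223211, 11223212,
    11233211, 11233212, 11234212, 11234312, 11234322, 12222101, 12222111, 12222211, 12223211,
    12223212, 12233211, 12233212, 12234212, 12234312, 12234322, 12333211, 12333212, 12334212,
    12334312, 12334322, 12344212, 12344312, 12344322, 12345312, 12345313, 12345322, 12345323,
    12345422, 12345423, 12346423, 12356423, 12456423, 13456423, 23456423]

/-- The `i`-th decimal digit, counted from the left, of an eight digit number. -/
def digit (n : ℕ) (i : Fin 8) : ℕ := n / 10 ^ (7 - i.1) % 10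

/-- The number obtained by reflecting the vector of digits. -/
def reflectCode (n : ℕ) (i : Fin 8) : ℕ :=
  n + (∑ j, adjE8 i j * digit n j - 2 * digit n i) * 10 ^ (7 - i.1)

lemma formE8_digit : ∀ n ∈ rootCodes, formE8 (fun j => digit n j) = 1 := by
  decide +kernel

lemma sum_digit : ∀ n ∈ rootCodes, ∑ j, digit n j * 10 ^ (7 - j.1) = n := by
  decide +kernel

lemma nodup_rootCodes : rootCodes.Nodup := by decide +kernel

lemma exists_digit_eq_single : ∀ i : Fin 8, ∃ n ∈ rootCodes, digit n = Pi.single i 1 := by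
  decide +kernel

lemma reflectCode_mem : ∀ n ∈ rootCodes, ∀ i, 2 * digit n i < ∑ j, adjE8 i j * digit n j →
    reflectCode n i ∈ rootCodes ∧ digit (reflectCode n i)
      = Function.update (digit n) i (∑ j, adjE8 i j * digit n j - digit n i) := by
  decide +kernel

lemma exists_digit_eq (hΦ : ∀ c : Fin 8 → ℕ, c ∈ Φ ↔ formE8 (fun j => c j) = 1)
    (c : Fin 8 → ℕ) (hc : c ∈ Φ) : ∃ n ∈ rootCodes, digit n = c := by
  induction hm : ∑ j, c j using Nat.strong_induction_on generalizing c with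
  | _ m ih =>
    obtain ⟨i, hi⟩ := exists_sum_adjE8_lt (fun j => c j) (fun _ => Int.natCast_nonneg _)
      fun h => (isPositiveRoots_adjE8 hΦ).ne_zero c hc (funext fun j => by simpa using congrFun h j)
    by_cases hs : c = Pi.single i 1
    · rw [hs]
      exact exists_digit_eq_single i
    obtain ⟨c', hc', hr⟩ := exists_reflect_mem hΦ hc hs
    have hr' : (fun j => (c j : ℤ)) = reflect adjE8 i fun j => (c' j : ℤ) := by
      rw [hr, reflect_reflect adjE8_self]
    have hne : ∀ j, j ≠ i → c' j = c j := fun j hj => by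
      have := congrFun hr j
      rw [reflect_of_ne hj] at this
      exact_mod_cast this
    have hi' := congrFun hr i
    have hi'' := congrFun hr' i
    rw [reflect_same] at hi' hi''
    have hlt : c' i < c i := by
      have : (c' i : ℤ) < c i := by linarith
      exact_mod_cast this
    obtain ⟨n, hn, rfl⟩ := ih (∑ j, c' j) (by
      rw [← hm]
      refine sum_lt_sum (fun j _ => ?_) ⟨i, mem_univ i, hlt⟩
      rcases eq_or_ne j i with rfl | hj
      · exact hlt.le
      · exact (hne j hj).le) c' hc' rfl
    have hsum : c i + digit n i = ∑ j, adjE8 i j * digit n j := by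
      have : (c i : ℤ) + digit n i = ∑ j, (adjE8 i j : ℤ) * digit n j := by linarith
      exact_mod_cast this
    obtain ⟨h1, h2⟩ := reflectCode_mem n hn i (by omega)
    refine ⟨_, h1, h2.trans (funext fun j => ?_)⟩
    rcases eq_or_ne j i with rfl | hj
    · rw [Function.update_self]; omega
    · rw [Function.update_of_ne hj, hne j hj]

/-- There are exactly `120` positive roots of type `E₈`. -/
lemma card_positiveRoots_E8 (hΦ : ∀ c : Fin 8 → ℕ, c ∈ Φ ↔ formE8 (fun j => c j) = 1) :
    Φ.card = 120 := by
  have h : Φ = rootCodes.toFinset.image digit := by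
    ext c
    simp only [mem_image, List.mem_toFinset]
    refine ⟨exists_digit_eq hΦ c, ?_⟩
    rintro ⟨n, hn, rfl⟩
    exact (hΦ _).mpr (formE8_digit n hn)
  rw [h, card_image_of_injOn, List.toFinset_card_of_nodup nodup_rootCodes]
  · rfl
  · intro n hn m hm hnm
    rw [← sum_digit n (by simpa using hn), ← sum_digit m (by simpa using hm), hnm]

/-- The exponent of `q` attached to a tuple of descending sequences. -/
noncomputable def exponentE8 (r : Fin 8 → ℕ → ℕ) : ℤ := ∑ᶠ t, formE8 fun i => (r i t : ℤ)

lemma exponentE8_nonneg (r : Fin 8 → ℕ → ℕ) : 0 ≤ exponentE8 r :=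
  finsum_nonneg fun _ => formE8_nonneg _

lemma exponentE8_eq (r : Fin 8 → DescSeq) :
    exponentE8 (fun i => (r i).1) = (∑ i : Fin 8, ∑ᶠ t : ℕ, ((r i).1 t : ℤ) ^ 2)
        - ∑ᶠ t : ℕ, (((r 0).1 t : ℤ) * ((r 1).1 t : ℤ) + ((r 1).1 t : ℤ) * ((r 2).1 t : ℤ)
            + ((r 2).1 t : ℤ) * ((r 3).1 t : ℤ) + ((r 3).1 t : ℤ) * ((r 4).1 t : ℤ)
            + ((r 4).1 t : ℤ) * ((r 5).1 t : ℤ) + ((r 5).1 t : ℤ) * ((r 6).1 t : ℤ)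
            + ((r 4).1 t : ℤ) * ((r 7).1 t : ℤ)) := by
  obtain ⟨B, hB⟩ := exists_bound r
  have h1 : ∀ i, ∑ᶠ t : ℕ, ((r i).1 t : ℤ) ^ 2 = ∑ t ∈ range B, ((r i).1 t : ℤ) ^ 2 := fun i =>
    finsum_eq_sum_range fun t ht => by simp [hB t ht]
  simp only [h1]
  rw [exponentE8, finsum_eq_sum_range (B := B) fun t ht => by simp [hB t ht, formE8],
    finsum_eq_sum_range (B := B) fun t ht => by simp [hB t ht], sum_comm, ← sum_sub_distrib]
  rfl

lemma isQuiverForm_exponentE8 :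
    IsQuiverForm adjE8 fun r => exponentE8 fun i => (r i).1 where
  zero := by simp [exponentE8, formE8, DescSeq.zero]
  update r i v hr := by
    obtain ⟨B, hB⟩ := exists_bound r
    obtain ⟨B', hB'⟩ := v.2.2
    have h : ∀ t, formE8 (fun j => ((Function.update r i v j).1 t : ℤ))
        = formE8 (fun j => ((r j).1 t : ℤ))
          + ((v.1 t : ℤ) ^ 2 - v.1 t * neighborSum adjE8 i r t) := by
      intro t
      have h1 : (fun j => ((Function.update r i v j).1 t : ℤ))
          = Function.update (fun j => ((r j).1 t : ℤ)) i (v.1 t) := by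
        funext j
        rcases eq_or_ne j i with rfl | hj
        · simp
        · simp [hj]
      have h2 : Function.update (fun j => ((r j).1 t : ℤ)) i 0 = fun j => ((r j).1 t : ℤ) :=
        Function.update_eq_self_iff.mpr (by simp [hr, DescSeq.zero])
      rw [h1, formE8_update, h2, neighborSum]
      push_cast
      rfl
    simp only [exponentE8, h]
    rw [finsum_eq_sum_range (B := max B B') fun t ht => ?_,
      finsum_eq_sum_range (B := max B B') fun t ht => ?_,
      finsum_eq_sum_range (B := max B B') fun t ht => ?_, sum_add_distrib]
    · simp [hB' t (le_of_max_le_right ht)]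
    · simp [hB t (le_of_max_le_left ht), formE8]
    · simp [hB t (le_of_max_le_left ht), hB' t (le_of_max_le_right ht), formE8]

end RootSystem

section Bridge

open Finset DescSeq

variable {n : ℕ}

/-- A power series in `n + 1` variables regarded as a power series in the last `n` variables. -/
noncomputable def headCoeff (F : MvPowerSeries (Fin (n + 1)) ℤ) :
    MvPowerSeries (Fin n) (PowerSeries ℤ) :=
  fun m => PowerSeries.mk fun k => coeff (m.cons k) F

lemma coeff_coeff_headCoeff (F : MvPowerSeries (Fin (n + 1)) ℤ) (m : Fin n →₀ ℕ) (k : ℕ) :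
    PowerSeries.coeff k (coeff m (headCoeff F)) = coeff (m.cons k) F :=
  PowerSeries.coeff_mk k fun k => coeff (m.cons k) F

lemma headCoeff_mul (F G : MvPowerSeries (Fin (n + 1)) ℤ) :
    headCoeff (F * G) = headCoeff F * headCoeff G := by
  ext m k
  rw [coeff_coeff_headCoeff, ← coeff_coeff_finSuccEquiv, map_mul, PowerSeries.coeff_mul,
    coeff_mul, map_sum, map_sum]
  simp only [coeff_mul, PowerSeries.coeff_mul, coeff_coeff_finSuccEquiv, coeff_coeff_headCoeff]
  exact sum_comm

lemma headCoeff_one : headCoeff (1 : MvPowerSeries (Fin (n + 1)) ℤ) = 1 := by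
  ext m k
  rw [coeff_coeff_headCoeff, coeff_one, coeff_one]
  simp only [← Finsupp.cons_zero_zero, Finsupp.cons_injective2.eq_iff]
  split_ifs with h1 h2 h2 <;> simp_all [PowerSeries.coeff_one]

/-- The field of fractions of the ring of power series in one variable. -/
abbrev QField := FractionRing (PowerSeries ℤ)

/-- The variable of `QField`. -/
noncomputable def qVar : QField := algebraMap (PowerSeries ℤ) QField PowerSeries.X

instance : CharZero (PowerSeries ℤ) :=
  charZero_of_injective_ringHom (PowerSeries.C_injective (R := ℤ))

lemma qVar_ne_zero : qVar ≠ 0 := by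
  rw [qVar, Ne, FaithfulSMul.algebraMap_eq_zero_iff]
  exact PowerSeries.X_ne_zero

lemma qVar_pow_ne_one (k : ℕ) : qVar ^ (k + 1) ≠ 1 := by
  rw [qVar, ← map_pow, ← map_one (algebraMap (PowerSeries ℤ) QField),
    (FaithfulSMul.algebraMap_injective _ _).ne_iff]
  intro h
  simpa using congrArg PowerSeries.constantCoeff h

/-- Power series in `n + 1` variables embedded in power series in the last `n` variables, with
coefficients in the field of fractions of the power series in the first one. -/
noncomputable def toQField :
    MvPowerSeries (Fin (n + 1)) ℤ →+* MvPowerSeries (Fin n) QField :=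
  (MvPowerSeries.map (algebraMap (PowerSeries ℤ) QField)).comp
    { toFun := headCoeff
      map_one' := headCoeff_one
      map_mul' := headCoeff_mul
      map_zero' := by ext m k; rw [coeff_coeff_headCoeff]; simp
      map_add' := fun F G => by ext m k; simp [coeff_coeff_headCoeff] }

lemma coeff_toQField (F : MvPowerSeries (Fin (n + 1)) ℤ) (m : Fin n →₀ ℕ) :
    coeff m (toQField F) = algebraMap (PowerSeries ℤ) QField (coeff m (headCoeff F)) := by
  rw [toQField, RingHom.comp_apply, coeff_map]
  rfl

lemma coeff_eq_of_coeff_toQField {F G : MvPowerSeries (Fin (n + 1)) ℤ} {m : Fin (n + 1) →₀ ℕ}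
    (h : coeff m.tail (toQField F) = coeff m.tail (toQField G)) : coeff m F = coeff m G := by
  rw [coeff_toQField, coeff_toQField, (FaithfulSMul.algebraMap_injective _ _).eq_iff] at h
  rw [← Finsupp.cons_tail m, ← coeff_coeff_headCoeff, ← coeff_coeff_headCoeff, h]

lemma exists_toQField_eq {H : MvPowerSeries (Fin n) QField}
    (h : ∀ m, ∃ f, coeff m H = algebraMap (PowerSeries ℤ) QField f) : ∃ F, toQField F = H := by
  choose f hf using h
  let F : MvPowerSeries (Fin (n + 1)) ℤ := fun m => PowerSeries.coeff (m 0) (f m.tail)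
  have hF : ∀ m, coeff m F = PowerSeries.coeff (m 0) (f m.tail) := fun _ => rfl
  refine ⟨F, ?_⟩
  ext m
  rw [coeff_toQField, hf]
  congr 1
  ext k
  rw [coeff_coeff_headCoeff, hF, Finsupp.cons_zero, Finsupp.tail_cons]

lemma toQField_X_zero : toQField (X 0 : MvPowerSeries (Fin (n + 1)) ℤ) = C qVar := by
  ext m
  rw [coeff_toQField, coeff_C, qVar]
  split_ifs with h
  · congr 1
    ext k
    rw [coeff_coeff_headCoeff, coeff_X, PowerSeries.coeff_X]
    simp [Finsupp.cons_eq_single_zero_iff, h]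
  · rw [FaithfulSMul.algebraMap_eq_zero_iff]
    ext k
    rw [coeff_coeff_headCoeff, coeff_X]
    simp [Finsupp.cons_eq_single_zero_iff, h]

lemma toQField_X_succ (i : Fin n) :
    toQField (X i.succ : MvPowerSeries (Fin (n + 1)) ℤ) = X i := by
  ext m
  rw [coeff_toQField, coeff_X]
  split_ifs with h
  · rw [← map_one (algebraMap (PowerSeries ℤ) QField)]
    congr 1
    ext k
    rw [coeff_coeff_headCoeff, coeff_X, PowerSeries.coeff_one]
    simp [Finsupp.cons_eq_single_succ_iff, h]
  · rw [FaithfulSMul.algebraMap_eq_zero_iff]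
    ext k
    rw [coeff_coeff_headCoeff, coeff_X]
    simp [Finsupp.cons_eq_single_succ_iff, h]

lemma toQField_prod_X_pow (c : Fin n → ℕ) :
    toQField (∏ i, (X i.succ : MvPowerSeries (Fin (n + 1)) ℤ) ^ c i)
      = monomial (Finsupp.equivFunOnFinite.symm c) 1 := by
  simp only [map_prod, map_pow, toQField_X_succ]
  rw [monomial_one_eq, Finsupp.prod_fintype _ _ (by simp)]
  rfl

lemma X_zero_pow_dvd {F : MvPowerSeries (Fin (n + 1)) ℤ} {M : ℕ}
    (h : ∀ m, ∃ f, coeff m (toQField F) = qVar ^ M * algebraMap (PowerSeries ℤ) QField f) :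
    X 0 ^ M ∣ F := by
  rw [X_pow_dvd_iff]
  intro m hm
  obtain ⟨f, hf⟩ := h m.tail
  rw [coeff_toQField, qVar, ← map_pow, ← map_mul,
    (FaithfulSMul.algebraMap_injective _ _).eq_iff] at hf
  rw [← Finsupp.cons_tail m, ← coeff_coeff_headCoeff, hf, PowerSeries.coeff_X_pow_mul', if_neg]
  omega

lemma exists_qFact_inv_eq (m : ℕ) :
    ∃ f, (qFact qVar m)⁻¹ = algebraMap (PowerSeries ℤ) QField f := by
  have hu : IsUnit (∏ u ∈ range m, (1 - (PowerSeries.X : PowerSeries ℤ) ^ (u + 1))) := by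
    rw [PowerSeries.isUnit_iff_constantCoeff]
    simp
  obtain ⟨u, hu⟩ := hu
  refine ⟨(u⁻¹ : (PowerSeries ℤ)ˣ), inv_eq_of_mul_eq_one_right ?_⟩
  have h : qFact qVar m = algebraMap (PowerSeries ℤ) QField u := by
    simp [hu, qFact, qVar]
  rw [h, ← map_mul, Units.mul_inv, map_one]

section Subst

variable {I K : Type*} [Fintype I] [Field K] {c : I → ℕ}

lemma coeff_nsmul_substMonomial (hc : c ≠ 0) (F : PowerSeries K) (k : ℕ) :
    coeff (k • Finsupp.equivFunOnFinite.symm c) (substMonomial c F) = PowerSeries.coeff k F := by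
  classical
  rw [substMonomial, PowerSeries.coeff_subst (hasSubst_monomial hc), finsum_eq_single _ k]
  · simp [monomial_pow]
  · intro l hl
    rw [monomial_pow, coeff_monomial_ne, smul_zero]
    obtain ⟨i, hi⟩ := Function.ne_iff.mp hc
    intro h
    have := DFunLike.congr_fun h i
    simp only [Finsupp.smul_apply, Finsupp.equivFunOnFinite_symm_apply_apply, smul_eq_mul] at this
    exact hl (Nat.eq_of_mul_eq_mul_right (Nat.pos_of_ne_zero hi) this).symm

lemma coeff_substMonomial_of_ne (hc : c ≠ 0) (F : PowerSeries K) {m : I →₀ ℕ}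
    (h : ∀ k : ℕ, m ≠ k • Finsupp.equivFunOnFinite.symm c) : coeff m (substMonomial c F) = 0 := by
  classical
  rw [substMonomial, PowerSeries.coeff_subst (hasSubst_monomial hc)]
  refine finsum_eq_zero_of_forall_eq_zero fun k => ?_
  rw [monomial_pow, coeff_monomial_ne (h k), smul_zero]

lemma substMonomial_linFactor (hc : c ≠ 0) (q : K) (k : ℕ) :
    substMonomial c (linFactor q k)
      = 1 - C (q ^ k) * monomial (Finsupp.equivFunOnFinite.symm c) 1 := by
  rw [substMonomial, linFactor, ← PowerSeries.smul_eq_C_mul,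
    ← PowerSeries.coe_substAlgHom (hasSubst_monomial hc), map_sub, map_one, map_smul,
    PowerSeries.coe_substAlgHom, PowerSeries.subst_X (hasSubst_monomial hc), smul_eq_C_mul]

lemma substMonomial_xPoch (hc : c ≠ 0) (q : K) (m : ℕ) :
    substMonomial c (xPoch q m) = ∏ k ∈ range m, substMonomial c (linFactor q (k + 1)) := by
  simp only [xPoch, substMonomial, ← PowerSeries.coe_substAlgHom (hasSubst_monomial hc), map_prod]

lemma rescale_pow_qExp {q : K} (hq : ∀ n : ℕ, q ^ (n + 1) ≠ 1) (m : ℕ) :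
    PowerSeries.rescale (q ^ m) (qExp q) = qExp q * xPoch q m := by
  induction m with
  | zero => simp [xPoch]
  | succ m ih =>
    rw [pow_succ, ← PowerSeries.rescale_rescale, ih, map_mul, rescale_qExp hq,
      ← linFactor_mul_rescale_xPoch]
    ring

end Subst

/-- The factor `1 - q ^ (k + 1) y ^ c`. -/
noncomputable def rootFactor (c : Fin n → ℕ) (k : ℕ) : MvPowerSeries (Fin (n + 1)) ℤ :=
  1 - X 0 ^ (k + 1) * ∏ i, X i.succ ^ c i

lemma isUnit_rootFactor (c : Fin n → ℕ) (k : ℕ) : IsUnit (rootFactor c k) := by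
  rw [isUnit_iff_constantCoeff]
  simp [rootFactor]

lemma toQField_rootFactor {c : Fin n → ℕ} (hc : c ≠ 0) (k : ℕ) :
    toQField (rootFactor c k) = substMonomial c (linFactor qVar (k + 1)) := by
  rw [rootFactor, map_sub, map_one, map_mul, map_pow, toQField_X_zero, toQField_prod_X_pow,
    substMonomial_linFactor hc, map_pow]

lemma exists_toQField_eq_qExp {c : Fin n → ℕ} (hc : c ≠ 0) :
    ∃ G, toQField G = substMonomial c (qExp qVar) := by
  refine exists_toQField_eq fun m => ?_
  by_cases h : ∃ k : ℕ, m = k • Finsupp.equivFunOnFinite.symm c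
  · obtain ⟨k, rfl⟩ := h
    obtain ⟨f, hf⟩ := exists_qFact_inv_eq k
    refine ⟨PowerSeries.X ^ k * f, ?_⟩
    rw [coeff_nsmul_substMonomial hc, qExp, PowerSeries.coeff_mk, hf, map_mul, map_pow, qVar]
  · exact ⟨0, by rw [coeff_substMonomial_of_ne hc _ (not_exists.mp h), map_zero]⟩

lemma X_zero_pow_dvd_mul_prod_sub_one {c : Fin n → ℕ} (hc : c ≠ 0)
    {G : MvPowerSeries (Fin (n + 1)) ℤ} (hG : toQField G = substMonomial c (qExp qVar)) (M : ℕ) :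
    X 0 ^ M ∣ G * ∏ k ∈ range M, rootFactor c k - 1 := by
  refine X_zero_pow_dvd fun m => ?_
  have h : toQField (G * ∏ k ∈ range M, rootFactor c k)
      = substMonomial c (PowerSeries.rescale (qVar ^ M) (qExp qVar)) := by
    rw [rescale_pow_qExp qVar_pow_ne_one, substMonomial_mul hc, substMonomial_xPoch hc, map_mul,
      map_prod, hG]
    simp only [toQField_rootFactor hc]
  rw [map_sub, map_one, map_sub, h]
  by_cases hm : ∃ k : ℕ, m = k • Finsupp.equivFunOnFinite.symm c
  · obtain ⟨k, rfl⟩ := hm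
    rw [coeff_nsmul_substMonomial hc, PowerSeries.coeff_rescale, qExp, PowerSeries.coeff_mk]
    cases k with
    | zero => exact ⟨0, by simp [qFact_zero]⟩
    | succ k =>
      obtain ⟨f, hf⟩ := exists_qFact_inv_eq (k + 1)
      refine ⟨PowerSeries.X ^ (M * k + (k + 1)) * f, ?_⟩
      rw [coeff_one, if_neg, hf, map_mul, map_pow, ← qVar]
      · ring
      · intro h0
        apply hc
        funext i
        simpa using DFunLike.congr_fun h0 i
  · refine ⟨0, ?_⟩
    rw [coeff_substMonomial_of_ne hc _ (not_exists.mp hm), coeff_one, if_neg]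
    · simp
    · rintro rfl
      exact hm ⟨0, by simp⟩

lemma dvd_prod_sub_one {R ι : Type*} [CommRing R] {a : R} {f : ι → R} {s : Finset ι}
    (h : ∀ i ∈ s, a ∣ f i - 1) : a ∣ ∏ i ∈ s, f i - 1 := by
  refine prod_induction f (fun x => a ∣ x - 1) (fun x y hx hy => ?_) (by simp) h
  have : x * y - 1 = x * (y - 1) + (x - 1) := by ring
  rw [this]
  exact dvd_add (hy.mul_left x) hx

lemma X_zero_pow_dvd_prod_inverse_sub {c : Fin n → ℕ} (hc : c ≠ 0)
    {G : MvPowerSeries (Fin (n + 1)) ℤ} (hG : toQField G = substMonomial c (qExp qVar)) {M : ℕ}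
    {s : Finset ℕ} (hs : range M ⊆ s) :
    X 0 ^ M ∣ ∏ k ∈ s, Ring.inverse (rootFactor c k) - G := by
  have h1 : (∏ k ∈ s, rootFactor c k) * ∏ k ∈ s, Ring.inverse (rootFactor c k) = 1 := by
    rw [← prod_mul_distrib]
    exact prod_eq_one fun k _ => Ring.mul_inverse_cancel _ (isUnit_rootFactor c k)
  have h2 : X 0 ^ M ∣ ∏ k ∈ s \ range M, rootFactor c k - 1 := by
    refine dvd_prod_sub_one fun k hk => ?_
    have hk' : M ≤ k + 1 := by
      have := (mem_sdiff.mp hk).2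
      rw [mem_range] at this
      omega
    rw [rootFactor, sub_sub_cancel_left, dvd_neg]
    exact (pow_dvd_pow _ hk').mul_right _
  rw [← prod_sdiff hs] at h1
  set D := ∏ k ∈ s \ range M, rootFactor c k
  set P := ∏ k ∈ range M, rootFactor c k
  set J := ∏ k ∈ s, Ring.inverse (rootFactor c k)
  have h3 : J - G = -(J * ((D - 1) + D * (G * P - 1))) := by linear_combination G * h1
  rw [h3, dvd_neg]
  exact (dvd_add h2 ((X_zero_pow_dvd_mul_prod_sub_one hc hG M).mul_left D)).mul_left J

lemma hasProd_inverse_rootFactor {c : Fin n → ℕ} (hc : c ≠ 0)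
    {G : MvPowerSeries (Fin (n + 1)) ℤ} (hG : toQField G = substMonomial c (qExp qVar)) :
    HasProd (fun k => Ring.inverse (rootFactor c k)) G := by
  rw [HasProd, SummationFilter.unconditional_filter]
  refine tendsto_pi_nhds.mpr fun m => tendsto_const_nhds.congr' ?_
  filter_upwards [Filter.eventually_ge_atTop (range (m 0 + 1))] with s hs
  have h := X_pow_dvd_iff.mp (X_zero_pow_dvd_prod_inverse_sub hc hG hs) m (Nat.lt_succ_self _)
  rw [map_sub, sub_eq_zero] at h
  exact h.symm

instance : T2Space (MvPowerSeries (Fin n) ℤ) := inferInstanceAs (T2Space ((Fin n →₀ ℕ) → ℤ))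

lemma toQField_inverse {F : MvPowerSeries (Fin (n + 1)) ℤ} (hF : IsUnit F) {a : QField}
    (h : toQField F = C a) (ha : a ≠ 0) : toQField (Ring.inverse F) = C a⁻¹ := by
  have h1 : C a * toQField (Ring.inverse F) = 1 := by
    rw [← h, ← map_mul, Ring.mul_inverse_cancel _ hF, map_one]
  rw [← one_mul (toQField _), ← map_one C, ← inv_mul_cancel₀ ha, map_mul, mul_assoc, h1, mul_one]

lemma toQField_inverse_qFact (m : ℕ) :
    toQField (Ring.inverse
      (∏ u ∈ range m, (1 - (X 0 : MvPowerSeries (Fin (n + 1)) ℤ) ^ (u + 1))))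
      = C (qFact qVar m)⁻¹ := by
  refine toQField_inverse ?_ ?_ (qFact_ne_zero qVar_pow_ne_one m)
  · rw [isUnit_iff_constantCoeff]
    simp
  · simp [qFact, toQField_X_zero]

/-- The summand attached to a tuple of descending sequences. -/
noncomputable def quiverTerm (e : ℕ) (r : Fin n → ℕ → ℕ) : MvPowerSeries (Fin (n + 1)) ℤ :=
  X 0 ^ e * (∏ i, X i.succ ^ (∑ᶠ t : ℕ, r i t)) * ∏ i, ∏ᶠ j : ℕ,
    Ring.inverse (∏ u ∈ range (r i j - r i (j + 1)), (1 - X 0 ^ (u + 1)))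

lemma toQField_quiverTerm (e : ℕ) (r : Fin n → DescSeq) :
    toQField (quiverTerm e fun i => (r i).1)
      = monomial (Finsupp.equivFunOnFinite.symm fun i => (r i).size)
        (qVar ^ e * ∏ i, descFact qVar (r i).1) := by
  obtain ⟨B, hB⟩ := exists_bound r
  have h : ∀ i, toQField (∏ᶠ j : ℕ, Ring.inverse
      (∏ u ∈ range ((r i).1 j - (r i).1 (j + 1)),
        (1 - (X 0 : MvPowerSeries (Fin (n + 1)) ℤ) ^ (u + 1)))) = C (descFact qVar (r i).1) := by
    intro i
    rw [finprod_eq_prod_range (B := B) fun t ht => by simp [hB t ht], descFact,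
      finprod_eq_prod_range (B := B) fun t ht => by simp [hB t ht, qFact_zero], map_prod, map_prod]
    simp only [toQField_inverse_qFact]
  rw [quiverTerm, map_mul, map_mul, map_pow, toQField_X_zero, toQField_prod_X_pow, map_prod]
  simp only [h]
  rw [← map_prod, ← map_pow, mul_right_comm, ← map_mul, ← smul_eq_C_mul, ← map_smul, smul_eq_mul,
    mul_one]
  rfl

lemma hasSum_quiverTerm {E : (Fin n → DescSeq) → ℤ} (hE : ∀ r, 0 ≤ E r)
    {L : MvPowerSeries (Fin (n + 1)) ℤ} (hL : toQField L = quiverSeries qVar E) :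
    HasSum (fun r : Fin n → DescSeq => quiverTerm (E r).toNat fun i => (r i).1) L := by
  refine Pi.hasSum.mpr fun m => ?_
  set S := Fintype.piFinset fun j : Fin n => level (m.tail j)
  have hr : ∀ r : Fin n → DescSeq, r ∈ S ↔
      m.tail = Finsupp.equivFunOnFinite.symm fun i => (r i).size := by
    intro r
    simp [S, mem_level, Finsupp.ext_iff, eq_comm]
  have hL' : coeff m L = coeff m (∑ r ∈ S, quiverTerm (E r).toNat fun i => (r i).1) := by
    apply coeff_eq_of_coeff_toQField
    rw [hL, coeff_quiverSeries, map_sum, map_sum]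
    refine sum_congr rfl fun r hrS => ?_
    rw [toQField_quiverTerm, ← (hr r).mp hrS, coeff_monomial_same, quiverWeight, ← zpow_natCast,
      Int.toNat_of_nonneg (hE r)]
  rw [map_sum] at hL'
  have key : HasSum (fun r : Fin n → DescSeq => coeff m (quiverTerm (E r).toNat fun i => (r i).1))
      (coeff m L) := by
    rw [hL']
    refine hasSum_sum_of_ne_finset_zero fun r hrS => ?_
    rw [← map_zero (coeff (R := ℤ) m)]
    apply coeff_eq_of_coeff_toQField
    rw [toQField_quiverTerm, coeff_monomial_ne (mt (hr r).mpr hrS), map_zero, map_zero]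
  exact key

end Bridge

/-- The identity of Theorem 7.3 in type `E₈`.  With
`Φ⁺ = {c ∈ ℕ⁸ : cᵀ A c = 2}` (the 120 positive roots of `E₈`), in `ℤ[[q, y₁, …, y₈]]`
(variables indexed by `Fin 9`, `q = X 0`, `yᵢ = X i.succ`):
`∏_{c ∈ Φ⁺} ∏_{n ≥ 1} (1 - qⁿ y^c)⁻¹
  = ∑_{(r₁,…,r₈) descending} q^{E r} (∏ᵢ yᵢ^{|rᵢ|}) ∏ᵢ ∏_{j ≥ 1} (q;q)_{rᵢ^{(j)}-rᵢ^{(j+1)}}⁻¹`,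
with `E r = ∑_{i=1}^{8} ∑_{t≥1} (rᵢ^{(t)})²
 - ∑_{t≥1} (r₁r₂ + r₂r₃ + r₃r₄ + r₄r₅ + r₅r₆ + r₆r₇ + r₅r₈)^{(t)}`,
a nonnegative integer. -/
theorem stmt_11
    (Φ : Finset (Fin 8 → ℕ))
    (hΦ : ∀ c : Fin 8 → ℕ, c ∈ Φ ↔ ∑ i, ∑ j, (c i : ℤ) * cartanE8 i j * (c j : ℤ) = 2)
    (E : (Fin 8 → ℕ → ℕ) → ℤ)
    (hE : ∀ r : Fin 8 → ℕ → ℕ, E r =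
      (∑ i : Fin 8, ∑ᶠ t : ℕ, (r i t : ℤ) ^ 2)
        - ∑ᶠ t : ℕ, ((r 0 t : ℤ) * (r 1 t : ℤ) + (r 1 t : ℤ) * (r 2 t : ℤ)
            + (r 2 t : ℤ) * (r 3 t : ℤ) + (r 3 t : ℤ) * (r 4 t : ℤ)
            + (r 4 t : ℤ) * (r 5 t : ℤ) + (r 5 t : ℤ) * (r 6 t : ℤ)
            + (r 4 t : ℤ) * (r 7 t : ℤ))) :
    Φ.card = 120
    ∧ (∀ r : Fin 8 → ℕ → ℕ, (∀ i, IsDescending (r i)) → 0 ≤ E r)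
    ∧ (∏ c ∈ Φ, ∏' n : ℕ,
          Ring.inverse (1 - (X 0 : MvPowerSeries (Fin 9) ℤ) ^ (n + 1)
            * ∏ i : Fin 8, (X i.succ : MvPowerSeries (Fin 9) ℤ) ^ c i))
      = ∑' r : {r : Fin 8 → ℕ → ℕ // ∀ i, IsDescending (r i)},
          (X 0 : MvPowerSeries (Fin 9) ℤ) ^ (E r.1).toNat
            * (∏ i : Fin 8, (X i.succ : MvPowerSeries (Fin 9) ℤ) ^ (∑ᶠ t : ℕ, r.1 i t))
            * ∏ i : Fin 8, ∏ᶠ j : ℕ,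
                Ring.inverse (∏ u ∈ Finset.range (r.1 i j - r.1 i (j + 1)),
                  (1 - (X 0 : MvPowerSeries (Fin 9) ℤ) ^ (u + 1))) := by
  have hΦ' : ∀ c : Fin 8 → ℕ, c ∈ Φ ↔ formE8 (fun j => (c j : ℤ)) = 1 := by
    intro c
    rw [hΦ, sum_cartanE8 fun j => (c j : ℤ)]
    omega
  have hE' : ∀ r : Fin 8 → DescSeq, E (fun i => (r i).1) = exponentE8 fun i => (r i).1 :=
    fun r => (hE _).trans (exponentE8_eq r).symm
  have hnonneg : ∀ r : Fin 8 → DescSeq, 0 ≤ E fun i => (r i).1 :=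
    fun r => hE' r ▸ exponentE8_nonneg _
  refine ⟨card_positiveRoots_E8 hΦ', fun r hr => hnonneg fun i => ⟨r i, hr i⟩, ?_⟩
  have hroots := isPositiveRoots_adjE8 hΦ'
  choose! G hG using fun (c : Fin 8 → ℕ) (hc : c ≠ 0) => exists_toQField_eq_qExp hc
  have hprod : ∀ c ∈ Φ, ∏' n : ℕ,
      Ring.inverse (1 - (X 0 : MvPowerSeries (Fin 9) ℤ) ^ (n + 1)
        * ∏ i : Fin 8, (X i.succ : MvPowerSeries (Fin 9) ℤ) ^ c i) = G c := fun c hc =>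
    (hasProd_inverse_rootFactor (hroots.ne_zero c hc) (hG c (hroots.ne_zero c hc))).tprod_eq
  rw [Finset.prod_congr rfl hprod]
  have hL : toQField (∏ c ∈ Φ, G c) = quiverSeries qVar fun r => E fun i => (r i).1 := by
    simp only [hE']
    rw [quiverSeries_eq_prod qVar_ne_zero qVar_pow_ne_one adjE8_self isQuiverForm_exponentE8
      exists_sum_adjE8_lt hroots, map_prod]
    exact Finset.prod_congr rfl fun c hc => hG c (hroots.ne_zero c hc)
  have hsum := hasSum_quiverTerm hnonneg hL
  rw [← (Equiv.subtypePiEquivPi (p := fun (_ : Fin 8) => IsDescending)).hasSum_iff] at hsum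
  exact hsum.tsum_eq.symm
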